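/- arXiv:1008.2040 — 3 statements merged into one kernel-verified Lean document; each statement's English description precedes it below -/
import Mathlib

section
/- Let P be a polytope in ℝ^d with facets F_1, …, F_m and inner unit normal vectors N_1, …, N_m of its facets. If the family {N_1, …, N_m} has absolute rank k, then the inner neighborhood volume function V_P(r) = vol_d(P \ P(r)) is a degree-d pluri-phase Steiner-like function of differentiability class C^{k−1} on [0, +∞). -/
open MeasureTheory Metric Set
open scoped RealInnerProductSpace

/-- The `r`-interior of a set `P`: points of `P` at distance at least `r` from `∂P`. -/
noncomputable def innerInterior {d : ℕ} (P : Set (EuclideanSpace ℝ (Fin d))) (r : ℝ) :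
    Set (EuclideanSpace ℝ (Fin d)) :=
  {x ∈ P | r ≤ infDist x (frontier P)}

/-- The inner neighborhood volume function `V_P(r) = vol_d(P \ P(r))`. -/
noncomputable def VP {d : ℕ} (P : Set (EuclideanSpace ℝ (Fin d))) (r : ℝ) : ℝ :=
  (volume (P \ innerInterior P r)).toReal

/-- A degree-`d` pluri-phase Steiner-like function. -/
def PluriPhaseSteinerLike (d : ℕ) (φ : ℝ → ℝ) : Prop :=
  ContinuousOn φ (Ici 0) ∧ (∀ r ∈ Ici (0 : ℝ), 0 ≤ φ r) ∧
    ∃ (n : ℕ) (g : Fin (n + 1) → ℝ), StrictMono g ∧ g 0 = 0 ∧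
      (∀ i : Fin n, ∃ p : Polynomial ℝ, p.natDegree ≤ d ∧
        ∀ r ∈ Icc (g i.castSucc) (g i.succ), φ r = p.eval r) ∧
      ∀ r, g (Fin.last n) ≤ r → φ r = φ (g (Fin.last n))

/-- A finite family of vectors has absolute rank `k` if any `k` of its elements are
linearly independent, and some `k+1` of them are linearly dependent. -/
def AbsoluteRank {E : Type*} [AddCommGroup E] [Module ℝ E] {m : ℕ}
    (N : Fin m → E) (k : ℕ) : Prop :=
  (∀ s : Finset (Fin m), s.card = k → LinearIndependent ℝ (fun i : s => N (i : Fin m))) ∧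
  ∃ s : Finset (Fin m), s.card = k + 1 ∧ ¬ LinearIndependent ℝ (fun i : s => N (i : Fin m))
open Filter Topology

/-- The polyhedron cut out by the half-spaces `b i ≤ ℓ i x`, `i ∈ s`. -/
def polyhedron {E ι : Type*} [NormedAddCommGroup E] [NormedSpace ℝ E]
    (ℓ : ι → E →L[ℝ] ℝ) (s : Finset ι) (b : ι → ℝ) : Set E :=
  {x | ∀ i ∈ s, b i ≤ ℓ i x}

section Partial

variable {ι : Type*} [Fintype ι] [DecidableEq ι]

theorem hasFDerivAt_of_continuousAt_partial {F : (ι → ℝ) → ℝ} {b : ι → ℝ}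
    {D : ι → (ι → ℝ) → ℝ}
    (hD : ∀ j, ∀ᶠ c in 𝓝 b, HasDerivAt (fun t => F (Function.update c j t)) (D j c) (c j))
    (hc : ∀ j, ContinuousAt (D j) b) :
    HasFDerivAt F (∑ j, D j b • ContinuousLinearMap.proj (R := ℝ) (φ := fun _ : ι => ℝ) j) b := by
  have key : ∀ T : Finset ι,
      (fun h : ι → ℝ => F (b + T.piecewise h 0) - F b - ∑ j ∈ T, D j b * h j)
        =o[𝓝 0] (fun h => h) := by
    intro T
    induction T using Finset.induction_on with
    | empty => simp
    | insert j T hj ih =>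
      have hw : Tendsto (fun h : ι → ℝ => b + T.piecewise h 0) (𝓝 0) (𝓝 b) := by
        have : Continuous fun h : ι → ℝ => b + T.piecewise h 0 := by
          refine continuous_const.add (continuous_pi fun i => ?_)
          by_cases hi : i ∈ T
          · simpa [hi] using continuous_apply i
          · simpa [hi] using continuous_const
        have h0 := this.tendsto 0
        have e : b + T.piecewise (0 : ι → ℝ) 0 = b := by
          ext i; by_cases hi : i ∈ T <;> simp [hi]
        rwa [e] at h0
      have hupd : Tendsto (fun p : (ι → ℝ) × ℝ => Function.update (b + T.piecewise p.1 0) j p.2)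
          (𝓝 0 ×ˢ 𝓝 (b j)) (𝓝 b) := by
        have h1 : Tendsto (fun p : (ι → ℝ) × ℝ => b + T.piecewise p.1 0)
          (𝓝 0 ×ˢ 𝓝 (b j)) (𝓝 b) := hw.comp tendsto_fst
        have h2 : Tendsto (fun p : (ι → ℝ) × ℝ => p.2) (𝓝 (0 : ι → ℝ) ×ˢ 𝓝 (b j)) (𝓝 (b j)) :=
          tendsto_snd
        simpa using h1.update j h2
      have step : (fun h : ι → ℝ => F (Function.update (b + T.piecewise h 0) j (b j + h j))
          - F (Function.update (b + T.piecewise h 0) j (b j)) - D j b * h j) =o[𝓝 0]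
          (fun h : ι → ℝ => h j) := by
        rw [Asymptotics.isLittleO_iff]
        intro ε hε
        have hseg : Tendsto (fun h : ι → ℝ => b j + h j) (𝓝 0) (𝓝 (b j)) := by
          have : Continuous fun h : ι → ℝ => b j + h j := by fun_prop
          simpa using this.tendsto 0
        have hclose : ∀ᶠ c in 𝓝 b, ‖D j c - D j b‖ < ε := by
          simpa [dist_eq_norm] using Metric.tendsto_nhds.1 (hc j) ε hε
        filter_upwards [Filter.Eventually.segment_of_prod_nhds
          (r := fun (h : ι → ℝ) (t : ℝ) =>
            HasDerivAt (fun t => F (Function.update (b + T.piecewise h 0) j t))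
              (D j (Function.update (b + T.piecewise h 0) j t)) t ∧
            ‖D j (Function.update (b + T.piecewise h 0) j t) - D j b‖ < ε)
          tendsto_const_nhds hseg
          (by simpa using hupd.eventually ((hD j).and hclose))] with h hh
        have := (convex_segment (b j) (b j + h j)).norm_image_sub_le_of_norm_hasFDerivWithin_le'
          (𝕜 := ℝ) (f := fun t => F (Function.update (b + T.piecewise h 0) j t))
          (f' := fun t => ContinuousLinearMap.toSpanSingleton ℝ
            (D j (Function.update (b + T.piecewise h 0) j t)))
          (φ := ContinuousLinearMap.toSpanSingleton ℝ (D j b)) (C := ε)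
          (fun t ht => by simpa using (hh t ht).1.hasFDerivAt.hasFDerivWithinAt)
          (fun t ht => by
            have h1 : ∀ x y : ℝ, ContinuousLinearMap.toSpanSingleton ℝ x
                - ContinuousLinearMap.toSpanSingleton ℝ y
                = ContinuousLinearMap.toSpanSingleton ℝ (x - y) := fun x y => by ext; simp
            rw [h1, ContinuousLinearMap.norm_toSpanSingleton]
            exact (hh t ht).2.le)
          (left_mem_segment ..) (right_mem_segment ..)
        simpa [mul_comm] using this
      have step' : (fun h : ι → ℝ => F (b + (insert j T).piecewise h 0) - F (b + T.piecewise h 0)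
          - D j b * h j) =o[𝓝 0] (fun h => h) := by
        have h1 : (fun h : ι → ℝ => h j) =O[𝓝 0] (fun h => h) := by
          exact Asymptotics.isBigO_of_le _ fun h => norm_le_pi_norm h j
        refine (step.trans_isBigO h1).congr_left fun h => ?_
        have e1 : Function.update (b + T.piecewise h 0) j (b j + h j)
            = b + (insert j T).piecewise h 0 := by
          ext i
          by_cases hi : i = j
          · subst hi; simp
          · simp [hi, Finset.piecewise]
        have e2 : Function.update (b + T.piecewise h 0) j (b j) = b + T.piecewise h 0 := by
          ext i
          by_cases hi : i = j
          · subst hi; simp [hj]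
          · simp [hi]
        simp only [e1, e2]
      refine (step'.add ih).congr_left fun h => ?_
      rw [Finset.sum_insert hj]
      ring
  have := key Finset.univ
  rw [hasFDerivAt_iff_isLittleO_nhds_zero]
  refine this.congr_left fun h => ?_
  simp

end Partial

section Finite

variable {E : Type*} [NormedAddCommGroup E] [NormedSpace ℝ E]
  {ι : Type*} {ℓ : ι → E →L[ℝ] ℝ} {s : Finset ι} {b : ι → ℝ}

theorem isClosed_polyhedron (ℓ : ι → E →L[ℝ] ℝ) (s : Finset ι) (b : ι → ℝ) :
    IsClosed (polyhedron ℓ s b) := by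
  have : polyhedron ℓ s b = ⋂ i ∈ s, {x | b i ≤ ℓ i x} := by ext; simp [polyhedron]
  rw [this]
  exact isClosed_biInter fun i _ => isClosed_le continuous_const (ℓ i).continuous

/-- If one polyhedron is bounded and satisfies its constraints strictly at some point, then all
polyhedra with the same normals are bounded. -/
theorem isBounded_polyhedron_of_slater {x₀ : E} (hx₀ : ∀ i ∈ s, b i < ℓ i x₀)
    (hb : Bornology.IsBounded (polyhedron ℓ s b)) (b' : ι → ℝ) :
    Bornology.IsBounded (polyhedron ℓ s b') := by
  have h1 : ∀ᶠ ε : ℝ in 𝓝[>] 0, ∀ i ∈ s, b i - ℓ i x₀ < ε * b' i := by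
    rw [Filter.eventually_all_finset]
    intro i hi
    have : Tendsto (fun ε : ℝ => ε * b' i) (𝓝[>] 0) (𝓝 0) := by
      have : Continuous fun ε : ℝ => ε * b' i := by fun_prop
      simpa using (this.tendsto 0).mono_left nhdsWithin_le_nhds
    exact this.eventually_const_lt (by linarith [hx₀ i hi])
  obtain ⟨ε, hε, hε0⟩ := (h1.and self_mem_nhdsWithin).exists
  have hε0 : 0 < ε := hε0
  obtain ⟨R, hR⟩ := hb.exists_norm_le
  refine (isBounded_iff_forall_norm_le).2 ⟨ε⁻¹ * (R + ‖x₀‖), fun x hx => ?_⟩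
  have hmem : x₀ + ε • x ∈ polyhedron ℓ s b := fun i hi => by
    have := mul_le_mul_of_nonneg_left (hx i hi) hε0.le
    have := hε i hi
    simp only [map_add, map_smul, smul_eq_mul]
    linarith
  have h2 : ‖ε • x‖ ≤ R + ‖x₀‖ := by
    calc ‖ε • x‖ = ‖(x₀ + ε • x) - x₀‖ := by simp
      _ ≤ ‖x₀ + ε • x‖ + ‖x₀‖ := norm_sub_le _ _
      _ ≤ _ := by gcongr; exact hR _ hmem
  rw [norm_smul, Real.norm_of_nonneg hε0.le] at h2
  rw [inv_mul_eq_div, le_div_iff₀ hε0]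
  linarith

end Finite

section Measure

variable {E : Type*} [NormedAddCommGroup E] [NormedSpace ℝ E] [FiniteDimensional ℝ E]
  [MeasurableSpace E] [BorelSpace E] {μ : Measure E} [μ.IsAddHaarMeasure]
  {ι : Type*} {ℓ : ι → E →L[ℝ] ℝ} {s : Finset ι}

theorem measure_hyperplane_eq_zero {f : E →L[ℝ] ℝ} (hf : f ≠ 0) (t : ℝ) :
    μ {x | f x = t} = 0 := by
  obtain ⟨v, hv⟩ : ∃ v, f v ≠ 0 := by
    by_contra! h
    exact hf (ContinuousLinearMap.ext h)
  have h := Measure.addHaar_affineSubspace μ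
    (AffineSubspace.comap f.toLinearMap.toAffineMap (AffineSubspace.mk' t (⊥ : Submodule ℝ ℝ)))
    (by
      intro h
      have h1 : ((t + 1) / f v) • v ∈ (⊤ : AffineSubspace ℝ E) := trivial
      rw [← h] at h1
      simp [AffineSubspace.mem_comap, AffineSubspace.mem_mk', hv] at h1)
  convert h using 2
  ext x
  simp [AffineSubspace.mem_mk', sub_eq_zero]

theorem continuousAt_measureReal_polyhedron [Finite ι]
    (hbd : ∀ b, Bornology.IsBounded (polyhedron ℓ s b)) {b : ι → ℝ}
    (hb : ∀ i ∈ s, ℓ i = 0 → b i ≠ 0) :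
    ContinuousAt (fun b => μ.real (polyhedron ℓ s b)) b := by
  have hfin : ∀ b, μ (polyhedron ℓ s b) ≠ ⊤ := fun b => (hbd b).measure_lt_top.ne
  refine (ENNReal.tendsto_toReal (hfin b)).comp ?_
  refine tendsto_measure_of_ae_tendsto_indicator (𝓝 b)
    (isClosed_polyhedron ℓ s b).measurableSet
    (fun b => (isClosed_polyhedron ℓ s b).measurableSet)
    (B := polyhedron ℓ s fun i => b i - 1) (isClosed_polyhedron ℓ s _).measurableSet (hfin _) ?_ ?_
  · have : ∀ᶠ c in 𝓝 b, ∀ i ∈ s, b i - 1 < c i := by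
      rw [Filter.eventually_all_finset]
      exact fun i _ => (continuous_apply i).continuousAt.eventually_const_lt (by simp)
    filter_upwards [this] with c hc x hx i hi
    exact (hc i hi).le.trans (hx i hi)
  · have : ∀ᵐ x ∂μ, ∀ i ∈ s, ℓ i x ≠ b i := by
      rw [Filter.eventually_all_finset]
      intro i hi
      by_cases h0 : ℓ i = 0
      · exact Eventually.of_forall fun x => by simpa [h0] using (hb i hi h0).symm
      · simpa [ae_iff] using measure_hyperplane_eq_zero (μ := μ) h0 (b i)
    filter_upwards [this] with x hx
    have : ∀ᶠ c in 𝓝 b, ∀ i ∈ s, (c i ≤ ℓ i x ↔ b i ≤ ℓ i x) := by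
      rw [Filter.eventually_all_finset]
      intro i hi
      rcases lt_or_gt_of_ne (hx i hi) with h | h
      · filter_upwards [(continuous_apply i).continuousAt.eventually_const_lt h] with c hc
        exact iff_of_false hc.not_ge h.not_ge
      · filter_upwards [(continuous_apply i).continuousAt.eventually_lt_const h] with c hc
        exact iff_of_true hc.le h.le
    filter_upwards [this] with c hc
    exact forall₂_congr hc

end Measure

section RestrictKer

variable {ι E : Type*} [NormedAddCommGroup E] [NormedSpace ℝ E]

/-- Restrictions of a family of functionals to the kernel of one of them. -/
def restrictKer (ℓ : ι → E →L[ℝ] ℝ) (j i : ι) : (ℓ j).ker →L[ℝ] ℝ :=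
  (ℓ i).comp (ℓ j).ker.subtypeL

theorem restrictKer_apply (ℓ : ι → E →L[ℝ] ℝ) (j i : ι) (y : (ℓ j).ker) :
    restrictKer ℓ j i y = ℓ i y := rfl

variable [DecidableEq ι] {ℓ : ι → E →L[ℝ] ℝ} {s : Finset ι}

theorem isBounded_polyhedron_restrictKer
    (hbd : ∀ b, Bornology.IsBounded (polyhedron ℓ s b)) (j : ι) (b : ι → ℝ) :
    Bornology.IsBounded (polyhedron (restrictKer ℓ j) (s.erase j) b) := by
  obtain ⟨R, hR⟩ := (hbd (Function.update b j 0)).exists_norm_le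
  refine (isBounded_iff_forall_norm_le).2 ⟨R, fun y hy => hR y fun i hi => ?_⟩
  by_cases hij : i = j
  · subst hij
    have : ℓ i y = 0 := y.2
    simp [this]
  · simpa [hij, restrictKer_apply] using hy i (Finset.mem_erase.2 ⟨hij, hi⟩)

theorem slice_polyhedron {j : ι} (c : ι → ℝ) (v : E) (u : ℝ) :
    {y : (ℓ j).ker | u • v + (y : E) ∈ polyhedron ℓ (s.erase j) c}
      = polyhedron (restrictKer ℓ j) (s.erase j) fun i => c i - u * ℓ i v := by
  ext y
  simp only [polyhedron, mem_ofPred_eq, map_add, map_smul, smul_eq_mul, restrictKer_apply,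
    sub_le_iff_le_add']

end RestrictKer

section Slice

variable {E : Type*} [NormedAddCommGroup E] [NormedSpace ℝ E] [FiniteDimensional ℝ E]
  [MeasurableSpace E] [BorelSpace E] {μ : Measure E} [μ.IsAddHaarMeasure]

theorem exists_measure_eq_lintegral_slice (μ : Measure E) [μ.IsAddHaarMeasure]
    {f : E →L[ℝ] ℝ} {v : E} (hv : f v = 1)
    (ν : Measure f.ker) [ν.IsAddHaarMeasure] :
    ∃ C : NNReal, ∀ S, MeasurableSet S →
      μ S = C * ∫⁻ t : ℝ, ν {y | t • v + (y : E) ∈ S} := by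
  let L : ℝ × f.ker →ₗ[ℝ] E := (LinearMap.toSpanSingleton ℝ E v).coprod f.ker.subtype
  have hL : Function.Bijective L := by
    constructor
    · rw [← LinearMap.ker_eq_bot, LinearMap.ker_eq_bot']
      rintro ⟨t, y, hy⟩ h
      have hy : f y = 0 := hy
      have h : t • v + y = 0 := by simpa [L] using h
      have ht : t = 0 := by simpa [hv, hy] using congrArg f h
      subst ht
      have : y = 0 := by simpa using h
      subst this
      rfl
    · intro x
      refine ⟨(f x, ⟨x - f x • v, ?_⟩), ?_⟩
      · change f (x - f x • v) = 0
        simp [hv]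
      · simp [L]
  let e := LinearEquiv.ofBijective L hL
  have he : ∀ p : ℝ × f.ker, e p = p.1 • v + (p.2 : E) := fun p => by simp [e, L]
  have hprop : ProperSpace f.ker := FiniteDimensional.proper ℝ _
  have hprop : ProperSpace E := FiniteDimensional.proper ℝ _
  have hec : Continuous e := LinearMap.continuous_of_finiteDimensional e.toLinearMap
  have hH : ((volume.prod ν).map e).IsAddHaarMeasure :=
    Measure.MapLinearEquiv.isAddHaarMeasure (volume.prod ν) e
  refine ⟨Measure.addHaarScalarFactor μ ((volume.prod ν).map e), fun S hS => ?_⟩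
  conv_lhs => rw [Measure.isAddLeftInvariant_eq_smul μ ((volume.prod ν).map e)]
  rw [Measure.smul_apply, Measure.map_apply hec.measurable hS,
    Measure.prod_apply (hec.measurable hS), ENNReal.smul_def, smul_eq_mul]
  simp only [preimage, mem_ofPred_eq, he]

variable {ι : Type*} [DecidableEq ι] {ℓ : ι → E →L[ℝ] ℝ} {s : Finset ι}

theorem measurable_measure_slice {j : ι} (ν : Measure (ℓ j).ker) [ν.IsAddHaarMeasure]
    (c : ι → ℝ) (v : E) :
    Measurable fun u : ℝ =>
      ν (polyhedron (restrictKer ℓ j) (s.erase j) fun i => c i - u * ℓ i v) := by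
  have hcl : IsClosed {p : ℝ × (ℓ j).ker | p.1 • v + (p.2 : E) ∈ polyhedron ℓ (s.erase j) c} :=
    (isClosed_polyhedron ℓ (s.erase j) c).preimage
      (f := fun p : ℝ × (ℓ j).ker => p.1 • v + (p.2 : E)) (by fun_prop)
  have hprop : ProperSpace (ℓ j).ker := FiniteDimensional.proper ℝ _
  have := measurable_measure_prodMk_left (ν := ν) hcl.measurableSet
  simpa only [preimage, mem_ofPred_eq, slice_polyhedron] using this

theorem exists_measureReal_polyhedron_sub_eq (μ : Measure E) [μ.IsAddHaarMeasure]
    (hbd : ∀ b, Bornology.IsBounded (polyhedron ℓ s b)) {j : ι} (hj : j ∈ s) {v : E}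
    (hv : ℓ j v = 1) (ν : Measure (ℓ j).ker) [ν.IsAddHaarMeasure] :
    ∃ C : ℝ, ∀ c : ι → ℝ, ∀ t t' : ℝ,
      μ.real (polyhedron ℓ s (Function.update c j t'))
        = μ.real (polyhedron ℓ s (Function.update c j t)) - C * ∫ u in t..t',
          ν.real (polyhedron (restrictKer ℓ j) (s.erase j) fun i => c i - u * ℓ i v) := by
  obtain ⟨C, hC⟩ := exists_measure_eq_lintegral_slice μ hv ν
  refine ⟨C, fun c => ?_⟩
  have hmem : ∀ t x, x ∈ polyhedron ℓ s (Function.update c j t) ↔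
      t ≤ ℓ j x ∧ x ∈ polyhedron ℓ (s.erase j) c := by
    intro t x
    conv_lhs => rw [← Finset.insert_erase hj]
    simp only [polyhedron, mem_ofPred_eq, Finset.forall_mem_insert, Function.update_self]
    refine and_congr_right fun _ => forall₂_congr fun i hi => ?_
    rw [Function.update_of_ne (Finset.ne_of_mem_erase hi)]
  have hslice := slice_polyhedron (s := s) (ℓ := ℓ) (j := j) c v
  have hmeas := measurable_measure_slice (s := s) ν c v
  have hfin : ∀ b, μ (polyhedron ℓ s b) ≠ ⊤ := fun b => (hbd b).measure_lt_top.ne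
  have key : ∀ t t' : ℝ, t ≤ t' →
      μ.real (polyhedron ℓ s (Function.update c j t'))
        = μ.real (polyhedron ℓ s (Function.update c j t)) - C * ∫ u in t..t',
          ν.real (polyhedron (restrictKer ℓ j) (s.erase j) fun i => c i - u * ℓ i v) := by
    intro t t' htt'
    have hsub : polyhedron ℓ s (Function.update c j t') ⊆
        polyhedron ℓ s (Function.update c j t) := fun x hx =>
      (hmem t x).2 ⟨htt'.trans ((hmem t' x).1 hx).1, ((hmem t' x).1 hx).2⟩
    have h1 := measureReal_sdiff (μ := μ) hsub
      (isClosed_polyhedron ℓ s (Function.update c j t')).measurableSet (hfin _)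
    have h2 := hC _ ((isClosed_polyhedron ℓ s (Function.update c j t)).measurableSet.diff
      (isClosed_polyhedron ℓ s (Function.update c j t')).measurableSet)
    have h3 : (fun u : ℝ => ν {y : (ℓ j).ker | u • v + (y : E) ∈
        polyhedron ℓ s (Function.update c j t) \ polyhedron ℓ s (Function.update c j t')})
        = (Ico t t').indicator fun u =>
          ν (polyhedron (restrictKer ℓ j) (s.erase j) fun i => c i - u * ℓ i v) := by
      ext u
      have hval : ∀ y : (ℓ j).ker, ℓ j (u • v + (y : E)) = u := fun y => by
        have : ℓ j y = 0 := y.2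
        simp [hv, this]
      by_cases hu : u ∈ Ico t t'
      · rw [indicator_of_mem hu, ← hslice]
        congr 1
        ext y
        simp only [mem_ofPred_eq, Set.mem_sdiff, hmem, hval]
        have := hu.1
        have := hu.2.not_ge
        tauto
      · rw [indicator_of_notMem hu]
        convert measure_empty (μ := ν)
        ext y
        simp only [mem_ofPred_eq, Set.mem_sdiff, hmem, hval, mem_empty_iff_false, iff_false]
        rw [mem_Ico, not_and, not_lt] at hu
        tauto
    rw [h3, lintegral_indicator measurableSet_Ico] at h2
    have h4 : ∫ u in t..t', ν.real (polyhedron (restrictKer ℓ j) (s.erase j)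
          fun i => c i - u * ℓ i v)
        = (∫⁻ u in Ico t t', ν (polyhedron (restrictKer ℓ j) (s.erase j)
          fun i => c i - u * ℓ i v)).toReal := by
      rw [intervalIntegral.integral_of_le htt', ← integral_Ico_eq_integral_Ioc]
      exact integral_toReal hmeas.aemeasurable
        (Eventually.of_forall fun u => (isBounded_polyhedron_restrictKer hbd j _).measure_lt_top)
    rw [h4]
    have h5 := congrArg ENNReal.toReal h2
    rw [ENNReal.toReal_mul, ENNReal.coe_toReal] at h5
    rw [← h5]
    have h6 : (μ (polyhedron ℓ s (Function.update c j t) \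
      polyhedron ℓ s (Function.update c j t'))).toReal = _ := h1
    rw [h6]
    ring
  intro t t'
  rcases le_total t t' with h | h
  · exact key t t' h
  · rw [intervalIntegral.integral_symm, key t' t h]
    ring

theorem exists_hasFDerivAt_measureReal_polyhedron [Fintype ι] (μ : Measure E)
    [μ.IsAddHaarMeasure] (hbd : ∀ b, Bornology.IsBounded (polyhedron ℓ s b)) {v : ι → E}
    (hv : ∀ j ∈ s, ℓ j (v j) = 1) (ν : ∀ j, Measure (ℓ j).ker) [∀ j, (ν j).IsAddHaarMeasure] :
    ∃ C : ι → ℝ, ∀ b : ι → ℝ,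
      (∀ j ∈ s, ∀ i ∈ s.erase j, restrictKer ℓ j i = 0 → b i - b j * ℓ i (v j) ≠ 0) →
      HasFDerivAt (fun b => μ.real (polyhedron ℓ s b))
        (∑ j ∈ s, (C j * (ν j).real (polyhedron (restrictKer ℓ j) (s.erase j)
          fun i => b i - b j * ℓ i (v j))) •
          ContinuousLinearMap.proj (R := ℝ) (φ := fun _ : ι => ℝ) j) b := by
  have hex : ∀ j, ∃ C : ℝ, j ∈ s → ∀ c : ι → ℝ, ∀ t t' : ℝ,
      μ.real (polyhedron ℓ s (Function.update c j t'))
        = μ.real (polyhedron ℓ s (Function.update c j t)) - C * ∫ u in t..t',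
          (ν j).real (polyhedron (restrictKer ℓ j) (s.erase j)
            fun i => c i - u * ℓ i (v j)) := by
    intro j
    by_cases hj : j ∈ s
    · obtain ⟨C, hC⟩ := exists_measureReal_polyhedron_sub_eq μ hbd hj (hv j hj) (ν j)
      exact ⟨C, fun _ => hC⟩
    · exact ⟨0, fun h => absurd h hj⟩
  choose C hC using hex
  refine ⟨fun j => -C j, fun b hb => ?_⟩
  have hcont : ∀ j ∈ s, ∀ c : ι → ℝ,
      (∀ i ∈ s.erase j, restrictKer ℓ j i = 0 → c i - c j * ℓ i (v j) ≠ 0) →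
      ContinuousAt (fun c => (ν j).real (polyhedron (restrictKer ℓ j) (s.erase j) c))
        (fun i => c i - c j * ℓ i (v j)) := fun j _ c hc =>
    continuousAt_measureReal_polyhedron (isBounded_polyhedron_restrictKer hbd j) hc
  have key := hasFDerivAt_of_continuousAt_partial
    (F := fun b => μ.real (polyhedron ℓ s b)) (b := b)
    (D := fun j c => if j ∈ s then -C j * (ν j).real (polyhedron (restrictKer ℓ j) (s.erase j)
          fun i => c i - c j * ℓ i (v j)) else 0) ?_ ?_
  · convert key using 1
    simp only [ite_smul, zero_smul]
    rw [Finset.sum_ite_mem, Finset.univ_inter]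
  · intro j
    by_cases hj : j ∈ s
    · have hev : ∀ᶠ c in 𝓝 b, ∀ i ∈ s.erase j, restrictKer ℓ j i = 0 →
          c i - c j * ℓ i (v j) ≠ 0 := by
        rw [Filter.eventually_all_finset]
        intro i hi
        rw [Filter.eventually_imp_distrib_left]
        intro h0
        have : Continuous fun c : ι → ℝ => c i - c j * ℓ i (v j) := by fun_prop
        exact this.continuousAt.eventually_ne (hb j hj i hi h0)
      filter_upwards [hev] with c hc
      rw [if_pos hj, funext (hC j hj c (c j))]
      have h1 : ContinuousAt (fun u : ℝ => (ν j).real (polyhedron (restrictKer ℓ j) (s.erase j)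
          fun i => c i - u * ℓ i (v j))) (c j) := by
        refine ContinuousAt.comp (f := fun u : ℝ => fun i => c i - u * ℓ i (v j))
          (hcont j hj c hc) ?_
        fun_prop
      have h2 : StronglyMeasurableAtFilter (fun u : ℝ => (ν j).real
          (polyhedron (restrictKer ℓ j) (s.erase j) fun i => c i - u * ℓ i (v j))) (𝓝 (c j)) :=
        (measurable_measure_slice (ν j) c (v j)).ennreal_toReal
          |>.aestronglyMeasurable.stronglyMeasurableAtFilter
      simpa using ((intervalIntegral.integral_hasDerivAt_right
        IntervalIntegrable.refl h2 h1).const_mul (C j)).const_sub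
          (μ.real (polyhedron ℓ s (Function.update c j (c j))))
    · refine Eventually.of_forall fun c => ?_
      simp only [hj, if_false]
      have h : ∀ t, polyhedron ℓ s (Function.update c j t) = polyhedron ℓ s c := fun t => ?_
      · simpa only [h] using hasDerivAt_const (c j) (μ.real (polyhedron ℓ s c))
      ext x
      refine forall₂_congr fun i hi => ?_
      rw [Function.update_of_ne (by rintro rfl; exact hj hi)]
  · intro j
    by_cases hj : j ∈ s
    · simp only [hj, if_true]
      refine continuousAt_const.mul ?_
      refine ContinuousAt.comp (f := fun c : ι → ℝ => fun i => c i - c j * ℓ i (v j))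
        (hcont j hj b (hb j hj)) ?_
      fun_prop
    · simpa only [hj, if_false] using continuousAt_const

end Slice

section Smooth

variable {ι : Type*} [DecidableEq ι]

theorem exists_apply_eq_one {E : Type*} [NormedAddCommGroup E] [NormedSpace ℝ E]
    {f : E →L[ℝ] ℝ} (hf : f ≠ 0) : ∃ v, f v = 1 := by
  obtain ⟨v, hv⟩ : ∃ v, f v ≠ 0 := by
    by_contra! h
    exact hf (ContinuousLinearMap.ext h)
  exact ⟨(f v)⁻¹ • v, by simp [hv]⟩

theorem LinearIndepOn.restrictKer {E : Type*} [NormedAddCommGroup E] [NormedSpace ℝ E]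
    {ℓ : ι → E →L[ℝ] ℝ} {j : ι} {t : Finset ι} (hj : j ∉ t)
    (h : LinearIndepOn ℝ ℓ (insert j t : Finset ι)) :
    LinearIndepOn ℝ (restrictKer ℓ j) (t : Set ι) := by
  obtain ⟨v, hv⟩ := exists_apply_eq_one (h.ne_zero (i := j) (by simp))
  rw [linearIndepOn_finset_iff] at h ⊢
  intro g hg i hi
  have hg' : ∀ y : (ℓ j).ker, ∑ i ∈ t, g i * ℓ i y = 0 := fun y => by
    simpa [restrictKer_apply] using DFunLike.congr_fun hg y
  have key := h (Function.update g j (-∑ i ∈ t, g i * ℓ i v)) (by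
    have hupd : ∑ i ∈ t, Function.update g j (-∑ i ∈ t, g i * ℓ i v) i • ℓ i
        = ∑ i ∈ t, g i • ℓ i := Finset.sum_congr rfl fun i hi => by
      rw [Function.update_of_ne (ne_of_mem_of_not_mem hi hj)]
    rw [Finset.sum_insert hj, Function.update_self, hupd]
    ext x
    have hx : ℓ j (x - ℓ j x • v) = 0 := by simp [hv]
    have := hg' ⟨x - ℓ j x • v, hx⟩
    simp only [map_sub, map_smul, smul_eq_mul, mul_sub, Finset.sum_sub_distrib] at this
    simp only [add_apply, smul_apply, sum_apply, smul_eq_mul, zero_apply, Finset.sum_mul, neg_mul]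
    rw [sub_eq_zero] at this
    rw [this, neg_add_eq_zero]
    exact Finset.sum_congr rfl fun i _ => by ring) i (Finset.mem_insert_of_mem hi)
  rwa [Function.update_of_ne (ne_of_mem_of_not_mem hi hj)] at key

theorem contDiff_measureReal_polyhedron [Fintype ι] (n : ℕ) {E : Type*} [NormedAddCommGroup E]
    [NormedSpace ℝ E] [FiniteDimensional ℝ E] [MeasurableSpace E] [BorelSpace E] (μ : Measure E)
    [μ.IsAddHaarMeasure] {ℓ : ι → E →L[ℝ] ℝ} {s : Finset ι}
    (hbd : ∀ b, Bornology.IsBounded (polyhedron ℓ s b))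
    (hli : ∀ t ⊆ s, t.card ≤ n + 1 → LinearIndepOn ℝ ℓ (t : Set ι)) :
    ContDiff ℝ n (fun b => μ.real (polyhedron ℓ s b)) := by
  have hne : ∀ i ∈ s, ℓ i ≠ 0 := fun i hi =>
    (hli {i} (by simpa using hi) (by simp)).ne_zero (by simp)
  induction n generalizing E s with
  | zero =>
    exact contDiff_zero.2 (continuous_iff_continuousAt.2 fun b =>
      continuousAt_measureReal_polyhedron hbd fun i hi h => absurd h (hne i hi))
  | succ n ih =>
    have hv : ∀ j, ∃ v, j ∈ s → ℓ j v = 1 := fun j => by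
      by_cases hj : j ∈ s
      · obtain ⟨v, hv⟩ := exists_apply_eq_one (hne j hj)
        exact ⟨v, fun _ => hv⟩
      · exact ⟨0, fun h => absurd h hj⟩
    choose v hv using hv
    have hprop : ∀ j, ProperSpace (ℓ j).ker := fun j => FiniteDimensional.proper ℝ _
    obtain ⟨C, hC⟩ := exists_hasFDerivAt_measureReal_polyhedron μ hbd hv
      (fun j => Measure.addHaar (G := (ℓ j).ker))
    have hli' : ∀ j ∈ s, ∀ t ⊆ s.erase j, t.card ≤ n + 1 →
        LinearIndepOn ℝ (restrictKer ℓ j) (t : Set ι) := by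
      intro j hj t ht hcard
      have hjt : j ∉ t := fun h => Finset.notMem_erase j s (ht h)
      refine LinearIndepOn.restrictKer hjt (hli _ ?_ ?_)
      · exact Finset.insert_subset hj (ht.trans (Finset.erase_subset _ _))
      · rw [Finset.card_insert_of_notMem hjt]; omega
    have hne' : ∀ j ∈ s, ∀ i ∈ s.erase j, restrictKer ℓ j i ≠ 0 := fun j hj i hi =>
      (hli' j hj {i} (by simpa using hi) (by simp)).ne_zero (by simp)
    push_cast
    refine contDiff_succ_iff_hasFDerivAt.2 ⟨_, ?_, fun b =>
      hC b fun j hj i hi h => absurd h (hne' j hj i hi)⟩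
    refine ContDiff.sum fun j hj => ContDiff.fun_smul (contDiff_const.mul ?_) contDiff_const
    have := ih (Measure.addHaar (G := (ℓ j).ker)) (isBounded_polyhedron_restrictKer hbd j)
      (hli' j hj) (hne' j hj)
    refine this.comp (f := fun b : ι → ℝ => fun i => b i - b j * ℓ i (v j)) ?_
    fun_prop

end Smooth

section Selection

open Polynomial

/-- At every point, the value of `f` agrees with that of one of finitely many polynomials of
degree at most `D`. -/
def IsPolynomialSelection (D : ℕ) (f : ℝ → ℝ) : Prop :=
  ∃ Q : Set ℝ[X], Q.Finite ∧ (∀ q ∈ Q, q.natDegree ≤ D) ∧ ∀ r, ∃ q ∈ Q, f r = q.eval r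

namespace IsPolynomialSelection

variable {D : ℕ} {f g : ℝ → ℝ}

theorem eval {p : ℝ[X]} (hp : p.natDegree ≤ D) : IsPolynomialSelection D fun r => p.eval r :=
  ⟨{p}, Set.finite_singleton p, by simpa using hp, fun r => ⟨p, rfl, rfl⟩⟩

theorem const (c : ℝ) : IsPolynomialSelection D fun _ => c := by
  simpa using eval (D := D) (p := C c) (by simp)

theorem add (hf : IsPolynomialSelection D f) (hg : IsPolynomialSelection D g) :
    IsPolynomialSelection D fun r => f r + g r := by
  obtain ⟨Q, hQ, hQD, hQf⟩ := hf
  obtain ⟨R, hR, hRD, hRg⟩ := hg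
  refine ⟨Set.image2 (· + ·) Q R, hQ.image2 _ hR, ?_, fun r => ?_⟩
  · rintro _ ⟨q, hq, p, hp, rfl⟩
    exact (natDegree_add_le q p).trans (max_le (hQD q hq) (hRD p hp))
  · obtain ⟨q, hq, hqr⟩ := hQf r
    obtain ⟨p, hp, hpr⟩ := hRg r
    exact ⟨q + p, ⟨q, hq, p, hp, rfl⟩, by simp [hqr, hpr]⟩

theorem sum {κ : Type*} {s : Finset κ} {f : κ → ℝ → ℝ}
    (hf : ∀ j ∈ s, IsPolynomialSelection D (f j)) :
    IsPolynomialSelection D fun r => ∑ j ∈ s, f j r := by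
  classical
  induction s using Finset.induction_on with
  | empty => simpa using const 0
  | insert j s hj ih =>
    simp only [Finset.sum_insert hj]
    exact (hf j (by simp)).add (ih fun i hi => hf i (Finset.mem_insert_of_mem hi))

theorem eval_mul {p : ℝ[X]} {k : ℕ} (hp : p.natDegree ≤ k) (hf : IsPolynomialSelection D f) :
    IsPolynomialSelection (D + k) fun r => p.eval r * f r := by
  obtain ⟨Q, hQ, hQD, hQf⟩ := hf
  refine ⟨(p * ·) '' Q, hQ.image _, ?_, fun r => ?_⟩
  · rintro _ ⟨q, hq, rfl⟩
    have := hQD q hq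
    exact natDegree_mul_le.trans (by omega)
  · obtain ⟨q, hq, hqr⟩ := hQf r
    exact ⟨p * q, ⟨q, hq, rfl⟩, by simp [hqr]⟩

theorem const_mul (c : ℝ) (hf : IsPolynomialSelection D f) :
    IsPolynomialSelection D fun r => c * f r := by
  simpa using eval_mul (p := C c) (k := 0) (by simp) hf

theorem of_finite {G : Set (ℝ → ℝ)} (hG : G.Finite) (h : ∀ g ∈ G, IsPolynomialSelection D g)
    (hf : ∀ r, ∃ g ∈ G, f r = g r) : IsPolynomialSelection D f := by
  choose! Q hQ hQD hQf using h
  refine ⟨⋃ g ∈ G, Q g, hG.biUnion hQ, ?_, fun r => ?_⟩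
  · simp only [Set.mem_iUnion]
    rintro q ⟨g, hg, hq⟩
    exact hQD g hg q hq
  · obtain ⟨g, hg, hgr⟩ := hf r
    obtain ⟨q, hq, hqr⟩ := hQf g hg r
    exact ⟨q, Set.mem_biUnion hg hq, hgr.trans hqr⟩

end IsPolynomialSelection

end Selection

section Polynomial

open Polynomial
open scoped Pointwise

variable {ι : Type*}

theorem polyhedron_smul {E : Type*} [NormedAddCommGroup E] [NormedSpace ℝ E]
    (ℓ : ι → E →L[ℝ] ℝ) (s : Finset ι) (b : ι → ℝ) {t : ℝ} (ht : 0 < t) :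
    polyhedron ℓ s (t • b) = t • polyhedron ℓ s b := by
  ext x
  rw [Set.mem_smul_set_iff_inv_smul_mem₀ ht.ne']
  refine forall₂_congr fun i _ => ?_
  rw [map_smul, smul_eq_mul, Pi.smul_apply, smul_eq_mul, le_inv_mul_iff₀ ht]

/-- Euler's identity for the volume, which is homogeneous in the offsets. -/
theorem finrank_mul_measureReal_polyhedron [Fintype ι] {E : Type*} [NormedAddCommGroup E]
    [NormedSpace ℝ E] [FiniteDimensional ℝ E] [MeasurableSpace E] [BorelSpace E] {μ : Measure E}
    [μ.IsAddHaarMeasure] {ℓ : ι → E →L[ℝ] ℝ} {s : Finset ι} {b : ι → ℝ}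
    {F' : (ι → ℝ) →L[ℝ] ℝ} (h : HasFDerivAt (fun b => μ.real (polyhedron ℓ s b)) F' b) :
    Module.finrank ℝ E * μ.real (polyhedron ℓ s b) = F' b := by
  have h1 : HasDerivAt (fun t : ℝ => μ.real (polyhedron ℓ s (t • b))) (F' b) 1 := by
    have h2 : HasDerivAt (fun t : ℝ => t • b) b 1 := by
      simpa using (hasDerivAt_id (1 : ℝ)).smul_const b
    refine HasFDerivAt.comp_hasDerivAt_of_eq (1 : ℝ) h h2 (by simp)
  have h3 : HasDerivAt (fun t : ℝ => μ.real (polyhedron ℓ s (t • b)))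
      (Module.finrank ℝ E * μ.real (polyhedron ℓ s b)) 1 := by
    have h4 : HasDerivAt (fun t : ℝ => t ^ Module.finrank ℝ E * μ.real (polyhedron ℓ s b))
      (Module.finrank ℝ E * μ.real (polyhedron ℓ s b)) 1 := by
      simpa using (hasDerivAt_pow (Module.finrank ℝ E) (1 : ℝ)).mul_const
        (μ.real (polyhedron ℓ s b))
    refine h4.congr_of_eventuallyEq ?_
    filter_upwards [lt_mem_nhds (zero_lt_one (α := ℝ))] with t ht
    rw [polyhedron_smul ℓ s b ht, measureReal_def, Measure.addHaar_smul, ENNReal.toReal_mul,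
      ENNReal.toReal_ofReal (abs_nonneg _), abs_of_nonneg (pow_nonneg ht.le _), measureReal_def]
  exact h3.unique h1

/-- Dropping redundant constraints from a polyhedron of positive volume. -/
theorem exists_subset_polyhedron_eq [DecidableEq ι] {E : Type*} [NormedAddCommGroup E]
    [NormedSpace ℝ E] [FiniteDimensional ℝ E] [MeasurableSpace E] [BorelSpace E] {μ : Measure E}
    [μ.IsAddHaarMeasure] {ℓ : ι → E →L[ℝ] ℝ} {s : Finset ι} {b : ι → ℝ}
    (hμ : μ (polyhedron ℓ s b) ≠ 0) :
    ∃ s', polyhedron ℓ s' b = polyhedron ℓ s b ∧ (∀ j ∈ s', ℓ j ≠ 0) ∧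
      ∀ j ∈ s', ∀ v, ℓ j v = 1 → ∀ i ∈ s'.erase j, restrictKer ℓ j i = 0 →
        b i - b j * ℓ i v ≠ 0 := by
  obtain ⟨s', hs', hmin⟩ := Finset.exists_min_image
    (s.powerset.filter fun s' => polyhedron ℓ s' b = polyhedron ℓ s b) Finset.card
    ⟨s, by simp⟩
  simp only [Finset.mem_filter, Finset.mem_powerset] at hs' hmin
  obtain ⟨hsub, heq⟩ := hs'
  have hdrop : ∀ i ∈ s', ¬ ∀ x, x ∈ polyhedron ℓ (s'.erase i) b → b i ≤ ℓ i x := by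
    intro i hi h
    have hE : polyhedron ℓ (s'.erase i) b = polyhedron ℓ s b := by
      rw [← heq]
      ext x
      refine ⟨fun hx k hk => ?_, fun hx k hk => hx k (Finset.mem_of_mem_erase hk)⟩
      by_cases hki : k = i
      · subst hki; exact h x hx
      · exact hx k (Finset.mem_erase.2 ⟨hki, hk⟩)
    have := hmin _ ⟨(Finset.erase_subset i s').trans hsub, hE⟩
    exact absurd this (not_le.2 (Finset.card_erase_lt_of_mem hi))
  have hne : ∀ j ∈ s', ℓ j ≠ 0 := by
    intro j hj h0
    obtain ⟨x, hx⟩ := nonempty_of_measure_ne_zero hμ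
    rw [← heq] at hx
    refine hdrop j hj fun y _ => ?_
    simpa [h0] using hx j hj
  refine ⟨s', heq, hne, fun j hj v hv i hi h0 hb => ?_⟩
  rw [Finset.mem_erase] at hi
  have hpar : ∀ x, ℓ i x = ℓ j x * ℓ i v := by
    intro x
    have hx : ℓ j (x - ℓ j x • v) = 0 := by simp [hv]
    have : ℓ i (x - ℓ j x • v) = 0 := DFunLike.congr_fun h0 ⟨_, hx⟩
    simpa [sub_eq_zero] using this
  have hb : b i = b j * ℓ i v := sub_eq_zero.1 hb
  rcases lt_trichotomy (ℓ i v) 0 with h | h | h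
  · refine hμ (measure_mono_null ?_ (measure_hyperplane_eq_zero (μ := μ) (hne j hj) (b j)))
    rw [← heq]
    intro x hx
    refine le_antisymm ?_ (hx j hj)
    have := hx i hi.2
    rw [hb, hpar x] at this
    exact (mul_le_mul_right_of_neg h).1 this
  · exact hne i hi.2 (by ext x; simp [hpar x, h])
  · refine hdrop i hi.2 fun x hx => ?_
    rw [hb, hpar x]
    exact mul_le_mul_of_nonneg_right (hx j (Finset.mem_erase.2 ⟨hi.1.symm, hj⟩)) h.le

theorem exists_strict_mem_polyhedron {E : Type*} [NormedAddCommGroup E]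
    [NormedSpace ℝ E] [FiniteDimensional ℝ E] [MeasurableSpace E] [BorelSpace E] {μ : Measure E}
    [μ.IsAddHaarMeasure] {ℓ : ι → E →L[ℝ] ℝ} {s : Finset ι} {b : ι → ℝ}
    (hμ : μ (polyhedron ℓ s b) ≠ 0) (hne : ∀ j ∈ s, ℓ j ≠ 0) :
    ∃ x, ∀ i ∈ s, b i < ℓ i x := by
  by_contra! h
  refine hμ (measure_mono_null (t := ⋃ i ∈ s, {x | ℓ i x = b i}) ?_ ?_)
  · intro x hx
    obtain ⟨i, hi, hix⟩ := h x
    exact Set.mem_biUnion hi (le_antisymm hix (hx i hi))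
  · exact (measure_biUnion_null_iff s.countable_toSet).2 fun i hi =>
      measure_hyperplane_eq_zero (hne i hi) (b i)

theorem isPolynomialSelection_measureReal_polyhedron [Fintype ι] [DecidableEq ι] (d : ℕ)
    {E : Type*} [NormedAddCommGroup E] [NormedSpace ℝ E] [FiniteDimensional ℝ E] [MeasurableSpace E]
    [BorelSpace E] (μ : Measure E) [μ.IsAddHaarMeasure] (hd : Module.finrank ℝ E = d)
    {ℓ : ι → E →L[ℝ] ℝ} {s : Finset ι}
    (hbd : ∀ b, Bornology.IsBounded (polyhedron ℓ s b)) (a b : ι → ℝ) :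
    IsPolynomialSelection d fun r => μ.real (polyhedron ℓ s fun i => b i + r * a i) := by
  induction d generalizing E s a b with
  | zero =>
    have : Subsingleton E := Module.finrank_zero_iff.1 hd
    refine IsPolynomialSelection.of_finite
      (Set.toFinite {fun _ => 0, fun _ => μ.real Set.univ}) ?_ fun r => ?_
    · simp only [Set.mem_insert_iff, Set.mem_singleton_iff, forall_eq_or_imp, forall_eq]
      exact ⟨.const 0, .const _⟩
    · rcases (polyhedron ℓ s fun i => b i + r * a i).eq_empty_or_nonempty with h | h
      · exact ⟨_, Or.inl rfl, by simp [h]⟩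
      · exact ⟨_, Or.inr rfl, by rw [Subsingleton.eq_univ_of_nonempty h]⟩
  | succ d ih =>
    have hv : ∀ j, ∃ v, ℓ j ≠ 0 → ℓ j v = 1 := fun j => by
      by_cases hj : ℓ j = 0
      · exact ⟨0, fun h => absurd hj h⟩
      · obtain ⟨v, hv⟩ := exists_apply_eq_one hj
        exact ⟨v, fun _ => hv⟩
    choose v hv using hv
    have hprop : ∀ j, ProperSpace (ℓ j).ker := fun j => FiniteDimensional.proper ℝ _
    have hsel : ∀ s' : Finset ι, ∃ g, IsPolynomialSelection (d + 1) g ∧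
        ((∀ b, Bornology.IsBounded (polyhedron ℓ s' b)) → (∀ j ∈ s', ℓ j ≠ 0) →
          ∀ r, (∀ j ∈ s', ∀ i ∈ s'.erase j, restrictKer ℓ j i = 0 →
            (b i + r * a i) - (b j + r * a j) * ℓ i (v j) ≠ 0) →
          μ.real (polyhedron ℓ s' fun i => b i + r * a i) = g r) := by
      intro s'
      by_cases hs' : (∀ b, Bornology.IsBounded (polyhedron ℓ s' b)) ∧ ∀ j ∈ s', ℓ j ≠ 0
      swap
      · exact ⟨_, .const 0, fun h1 h2 => absurd ⟨h1, h2⟩ hs'⟩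
      obtain ⟨hbd', hne⟩ := hs'
      obtain ⟨C, hC⟩ := exists_hasFDerivAt_measureReal_polyhedron μ hbd'
        (fun j hj => hv j (hne j hj)) (fun j => Measure.addHaar (G := (ℓ j).ker))
      refine ⟨fun r => ((d + 1 : ℕ) : ℝ)⁻¹ * ∑ j ∈ s',
        (Polynomial.C (b j) + X * Polynomial.C (a j)).eval r *
        (C j * (Measure.addHaar (G := (ℓ j).ker)).real (polyhedron (restrictKer ℓ j) (s'.erase j)
          fun i => (b i - b j * ℓ i (v j)) + r * (a i - a j * ℓ i (v j)))), ?_, ?_⟩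
      · refine .const_mul _ (.sum fun j hj =>
          .eval_mul (k := 1) (by compute_degree) (.const_mul _ ?_))
        refine ih _ ?_ (isBounded_polyhedron_restrictKer hbd' j) _ _
        have := Module.Dual.finrank_ker_add_one_of_ne_zero (f := (ℓ j : E →ₗ[ℝ] ℝ))
          fun h => hne j hj (ContinuousLinearMap.coe_injective h)
        omega
      · intro _ _ r hr
        have h := finrank_mul_measureReal_polyhedron (hC _ hr)
        rw [eq_inv_mul_iff_mul_eq₀ (by positivity), ← hd, h]
        simp only [sum_apply, smul_apply, ContinuousLinearMap.proj_apply, smul_eq_mul]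
        refine Finset.sum_congr rfl fun j _ => ?_
        have : (fun i => b i + r * a i - (b j + r * a j) * ℓ i (v j))
          = fun i => (b i - b j * ℓ i (v j)) + r * (a i - a j * ℓ i (v j)) := by ext i; ring
        rw [this]
        simp only [eval_add, eval_mul, eval_C, eval_X]
        ring
    choose g hg hgF using hsel
    refine IsPolynomialSelection.of_finite (G := insert (fun _ => 0) (Set.range g))
      ((Set.finite_range g).insert _) ?_ fun r => ?_
    · rintro _ (rfl | ⟨s', rfl⟩)
      · exact .const 0
      · exact hg s'
    by_cases hμ : μ (polyhedron ℓ s fun i => b i + r * a i) = 0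
    · exact ⟨_, Or.inl rfl, by simp [measureReal_def, hμ]⟩
    obtain ⟨s', heq, hne, hreg⟩ := exists_subset_polyhedron_eq hμ
    refine ⟨g s', Or.inr ⟨s', rfl⟩, ?_⟩
    rw [← heq] at hμ ⊢
    obtain ⟨x, hx⟩ := exists_strict_mem_polyhedron hμ hne
    exact hgF s' (isBounded_polyhedron_of_slater hx (heq ▸ hbd _)) hne r
      fun j hj => hreg j hj (v j) (hv j (hne j hj))

end Polynomial

section Assembly

open Polynomial

theorem IsPolynomialSelection.exists_finset_eqOn {D : ℕ} {f : ℝ → ℝ}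
    (hf : IsPolynomialSelection D f) (hc : Continuous f) :
    ∃ B : Finset ℝ, ∀ a b, a < b → (∀ x ∈ B, x ∉ Ioo a b) →
      ∃ q : ℝ[X], q.natDegree ≤ D ∧ ∀ r ∈ Icc a b, f r = q.eval r := by
  classical
  obtain ⟨Q, hQ, hQD, hQf⟩ := hf
  refine ⟨(hQ.toFinset ×ˢ hQ.toFinset).biUnion fun p => (p.1 - p.2).roots.toFinset,
    fun a b hab hB => ?_⟩
  obtain ⟨q, hq, hqm⟩ := hQf ((a + b) / 2)
  refine ⟨q, hQD q hq, ?_⟩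
  have hclosed : ∀ p : ℝ[X], IsClosed {r | f r = p.eval r} := fun p =>
    isClosed_eq hc p.continuous
  have hIoo : EqOn f q.eval (Ioo a b) := by
    by_contra! hne
    obtain ⟨y, hy, hyq⟩ : ∃ y ∈ Ioo a b, f y ≠ q.eval y := by
      simpa [EqOn, and_assoc] using hne
    obtain ⟨z, hz, hzq, hzu⟩ := isPreconnected_closed_iff.1 (isPreconnected_Ioo (a := a) (b := b))
      {r | f r = q.eval r} (⋃ p ∈ Q \ {q}, {r | f r = p.eval r}) (hclosed q)
      (hQ.sdiff.isClosed_biUnion fun p _ => hclosed p)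
      (fun r _ => by
        obtain ⟨p, hp, hpr⟩ := hQf r
        by_cases hpq : p = q
        · exact Or.inl (hpq ▸ hpr)
        · exact Or.inr (Set.mem_biUnion ⟨hp, hpq⟩ hpr))
      ⟨(a + b) / 2, ⟨by linarith, by linarith⟩, hqm⟩
      ⟨y, hy, by
        obtain ⟨p, hp, hpy⟩ := hQf y
        exact Set.mem_biUnion ⟨hp, fun h => hyq (h ▸ hpy)⟩ hpy⟩
    obtain ⟨p, ⟨hp, hpq⟩, hzp⟩ := Set.mem_iUnion₂.1 hzu
    refine hB z ?_ hz
    refine Finset.mem_biUnion.2 ⟨(q, p), by simp [hq, hp], ?_⟩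
    have hqp : q - p ≠ 0 := fun h => hpq (sub_eq_zero.1 h).symm
    have hzq : f z = q.eval z := hzq
    have hzp : f z = p.eval z := hzp
    simp [mem_roots hqp, ← hzq, ← hzp]
  have := hIoo.closure hc q.continuous
  rwa [closure_Ioo hab.ne] at this

theorem IsPolynomialSelection.exists_partition {D : ℕ} {f : ℝ → ℝ}
    (hf : IsPolynomialSelection D f) (hc : Continuous f) {R : ℝ} (hR : 0 < R) :
    ∃ (n : ℕ) (g : Fin (n + 1) → ℝ), StrictMono g ∧ g 0 = 0 ∧ g (Fin.last n) = R ∧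
      ∀ i : Fin n, ∃ p : ℝ[X], p.natDegree ≤ D ∧
        ∀ r ∈ Icc (g i.castSucc) (g i.succ), f r = p.eval r := by
  classical
  obtain ⟨B, hB⟩ := hf.exists_finset_eqOn hc
  set G : Finset ℝ := insert 0 (insert R (B.filter (· ∈ Ioo 0 R))) with hG
  have hGle : ∀ x ∈ G, 0 ≤ x ∧ x ≤ R := by
    intro x hx
    simp only [hG, Finset.mem_insert, Finset.mem_filter] at hx
    rcases hx with rfl | rfl | ⟨-, h1, h2⟩
    exacts [⟨le_rfl, hR.le⟩, ⟨hR.le, le_rfl⟩, ⟨h1.le, h2.le⟩]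
  have h0 : (0 : ℝ) ∈ G := by simp [hG]
  have hRG : R ∈ G := by simp [hG]
  obtain ⟨n, hn⟩ : ∃ n, G.card = n + 1 :=
    Nat.exists_eq_succ_of_ne_zero (Finset.card_ne_zero_of_mem h0)
  have hmem : ∀ x ∈ G, ∃ j, G.orderEmbOfFin hn j = x := fun x hx => by
    have : x ∈ Set.range (G.orderEmbOfFin hn) := by simpa using hx
    exact this
  have hge : ∀ j, 0 ≤ G.orderEmbOfFin hn j ∧ G.orderEmbOfFin hn j ≤ R := fun j =>
    hGle _ (G.orderEmbOfFin_mem hn j)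
  have hmono := (G.orderEmbOfFin hn).strictMono
  refine ⟨n, G.orderEmbOfFin hn, hmono, ?_, ?_, fun i => ?_⟩
  · obtain ⟨j, hj⟩ := hmem 0 h0
    exact le_antisymm (hj ▸ hmono.monotone (Fin.zero_le j)) (hge 0).1
  · obtain ⟨j, hj⟩ := hmem R hRG
    exact le_antisymm (hge _).2 (hj ▸ hmono.monotone (Fin.le_last j))
  · refine hB _ _ (hmono i.castSucc_lt_succ) fun x hxB hx => ?_
    have hxG : x ∈ G := by
      simp only [hG, Finset.mem_insert, Finset.mem_filter]
      exact Or.inr (Or.inr ⟨hxB, (hge _).1.trans_lt hx.1, hx.2.trans_le (hge _).2⟩)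
    obtain ⟨j, rfl⟩ := hmem x hxG
    have h1 := hmono.lt_iff_lt.1 hx.1
    have h2 := hmono.lt_iff_lt.1 hx.2
    rw [Fin.lt_def] at h1 h2
    simp only [Fin.val_castSucc, Fin.val_succ] at h1 h2
    omega

theorem innerInterior_polyhedron {d m : ℕ} [Nonempty (Fin m)]
    {N : Fin m → EuclideanSpace ℝ (Fin d)} (hN : ∀ j, ‖N j‖ = 1) {c : Fin m → ℝ}
    {r : ℝ} (hr : 0 ≤ r) :
    innerInterior (polyhedron (fun j => innerSL ℝ (N j)) Finset.univ c) r
      = polyhedron (fun j => innerSL ℝ (N j)) Finset.univ fun i => c i + r * 1 := by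
  set P := polyhedron (fun j => innerSL ℝ (N j)) Finset.univ c with hPdef
  have hout : ∀ x j, ∀ ε > 0, x - (⟪N j, x⟫ - c j + ε) • N j ∈ Pᶜ := by
    intro x j ε hε hx
    have := hx j (Finset.mem_univ j)
    simp only [innerSL_apply_apply, inner_sub_right, inner_smul_right,
      real_inner_self_eq_norm_sq, hN] at this
    linarith
  have huniv : P ≠ univ := by
    obtain ⟨j⟩ := ‹Nonempty (Fin m)›
    exact fun h => hout 0 j 1 one_pos (h ▸ mem_univ _)
  ext x
  refine ⟨fun ⟨hxP, hx⟩ j _ => ?_, fun hx => ?_⟩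
  · obtain ⟨y, hy, hyd⟩ := exists_mem_frontier_infDist_compl_eq_dist hxP huniv
    have h1 : r ≤ infDist x Pᶜ := hx.trans (hyd ▸ infDist_le_dist_of_mem hy)
    have hxj : c j ≤ ⟪N j, x⟫ := hxP j (Finset.mem_univ j)
    have h2 : r ≤ ⟪N j, x⟫ - c j := by
      refine le_of_forall_pos_le_add fun ε hε => ?_
      refine h1.trans ((infDist_le_dist_of_mem (hout x j ε hε)).trans ?_)
      rw [dist_eq_norm, sub_sub_cancel, norm_smul, hN, mul_one, Real.norm_of_nonneg (by linarith)]
    change c j + r * 1 ≤ ⟪N j, x⟫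
    linarith
  · have hxP : x ∈ P := fun j hj => by
      have := hx j hj
      linarith
    refine ⟨hxP, ?_⟩
    have hfne : (frontier P).Nonempty := by
      obtain ⟨y, hy, -⟩ := exists_mem_frontier_infDist_compl_eq_dist hxP huniv
      exact ⟨y, hy⟩
    refine (le_infDist hfne).2 fun y hy => ?_
    obtain ⟨j, hj⟩ : ∃ j, ⟪N j, y⟫ ≤ c j := by
      by_contra! h
      refine hy.2 (mem_interior.2 ⟨{z | ∀ j, c j < ⟪N j, z⟫}, fun z hz j _ => (hz j).le, ?_, h⟩)
      simp only [ofPred_forall]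
      exact isOpen_iInter_of_finite fun j => isOpen_lt (by fun_prop) (by fun_prop)
    have hxj : c j + r * 1 ≤ ⟪N j, x⟫ := hx j (Finset.mem_univ j)
    have h3 := real_inner_le_norm (N j) (x - y)
    rw [inner_sub_right, hN, one_mul, ← dist_eq_norm] at h3
    linarith

theorem AbsoluteRank.linearIndepOn {E : Type*} [AddCommGroup E] [Module ℝ E] {m k : ℕ}
    {N : Fin m → E} (h : AbsoluteRank N k) {t : Finset (Fin m)} (ht : t.card ≤ k) :
    LinearIndepOn ℝ N (t : Set (Fin m)) := by
  obtain ⟨s, hs, -⟩ := h.2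
  obtain ⟨u, htu, -, hu⟩ := Finset.exists_subsuperset_card_eq (Finset.subset_univ t) ht
    ((Nat.le_succ k).trans (hs.ge.trans (Finset.card_le_univ s)))
  exact LinearIndepOn.mono (h.1 u hu) (by exact_mod_cast htu)

end Assembly

/-- If the inner unit normal vectors of the facets of a polytope `P` in `ℝ^d`
have absolute rank `k`, then `V_P` is a degree-`d` pluri-phase Steiner-like function of class
`C^{k-1}` on `[0,∞)`. -/
theorem statement1 {d m k : ℕ} (P : Set (EuclideanSpace ℝ (Fin d)))
    (N : Fin m → EuclideanSpace ℝ (Fin d)) (c : Fin m → ℝ)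
    (hN : ∀ j, ‖N j‖ = 1)
    (hP : P = ⋂ j, {x : EuclideanSpace ℝ (Fin d) | c j ≤ ⟪x, N j⟫})
    (hmin : ∀ j : Fin m,
      (⋂ i ∈ Finset.univ.erase j, {x : EuclideanSpace ℝ (Fin d) | c i ≤ ⟪x, N i⟫}) ≠ P)
    (hcomp : IsCompact P)
    (hint : (interior P).Nonempty)
    (hrank : AbsoluteRank N k) :
    PluriPhaseSteinerLike d (VP P) ∧ ContDiffOn ℝ (k - 1 : ℕ) (VP P) (Ici 0) := by
  have hP' : P = polyhedron (fun j => innerSL ℝ (N j)) Finset.univ c := by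
    ext x
    simp [hP, polyhedron, real_inner_comm]
  obtain ⟨j₀⟩ : Nonempty (Fin m) := by
    obtain ⟨s, hs, -⟩ := hrank.2
    obtain ⟨j, -⟩ := Finset.card_pos.1 (k.succ_pos.trans_eq hs.symm)
    exact ⟨j⟩
  have hk : 1 ≤ k := by
    by_contra! hk
    obtain rfl : k = 0 := by omega
    obtain ⟨s, hs, hdep⟩ := hrank.2
    obtain ⟨j, rfl⟩ := Finset.card_eq_one.1 hs
    refine hdep (LinearIndepOn.singleton (v := N) (i := j) ?_ |>.mono (by simp))
    exact norm_ne_zero_iff.1 (by simp [hN j])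
  obtain ⟨x₀, hx₀⟩ := hint
  have hslater : ∀ i ∈ Finset.univ, c i < innerSL ℝ (N i) x₀ := by
    intro i _
    obtain ⟨ε, hε, hball⟩ := Metric.isOpen_iff.1 isOpen_interior x₀ hx₀
    have hmem : x₀ - (ε / 2) • N i ∈ P := by
      refine interior_subset (hball ?_)
      rw [mem_ball, dist_eq_norm, sub_sub_cancel_left, norm_neg, norm_smul, hN, mul_one,
        Real.norm_of_nonneg (by positivity)]
      linarith
    rw [hP'] at hmem
    have := hmem i (Finset.mem_univ i)
    simp only [innerSL_apply_apply, inner_sub_right, inner_smul_right,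
      real_inner_self_eq_norm_sq, hN] at this
    rw [innerSL_apply_apply]
    linarith
  have hbd := isBounded_polyhedron_of_slater hslater (hP' ▸ hcomp.isBounded)
  set f : ℝ → ℝ := fun r => volume.real
    (polyhedron (fun j => innerSL ℝ (N j)) Finset.univ fun i => c i + r * 1) with hf
  have hVP : ∀ r, 0 ≤ r → VP P r = volume.real P - f r := by
    intro r hr
    have hin : innerInterior P r
        = polyhedron (fun j => innerSL ℝ (N j)) Finset.univ fun i => c i + r * 1 := by
      have : Nonempty (Fin m) := ⟨j₀⟩
      rw [hP']
      exact innerInterior_polyhedron hN hr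
    rw [VP, ← measureReal_def, measureReal_sdiff (fun x hx => hx.1) ?_
      hcomp.measure_lt_top.ne, hin]
    rw [hin]
    exact (isClosed_polyhedron _ _ _).measurableSet
  have hsmooth : ContDiff ℝ (k - 1 : ℕ) f := by
    have h := contDiff_measureReal_polyhedron (k - 1) volume hbd fun t _ ht => by
      refine LinearIndependent.map' (hrank.linearIndepOn (by omega))
        (innerSL ℝ : EuclideanSpace ℝ (Fin d) →L[ℝ] _).toLinearMap ?_
      rw [LinearMap.ker_eq_bot]
      exact (InnerProductSpace.toDual ℝ (EuclideanSpace ℝ (Fin d))).injective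
    refine h.comp (f := fun r : ℝ => fun i => c i + r * 1) ?_
    fun_prop
  have hdiff : ContDiffOn ℝ (k - 1 : ℕ) (VP P) (Ici 0) :=
    (contDiff_const.sub hsmooth).contDiffOn.congr hVP
  refine ⟨⟨hdiff.continuousOn, fun r _ => ENNReal.toReal_nonneg, ?_⟩, hdiff⟩
  obtain ⟨R, hR⟩ := hcomp.isBounded.exists_norm_le
  have hzero : ∀ r, 1 + |R| + |c j₀| ≤ r → f r = 0 := by
    intro r hr
    have : (polyhedron (fun j => innerSL ℝ (N j)) Finset.univ fun i => c i + r * 1) = ∅ := by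
      refine eq_empty_of_forall_notMem fun x hx => ?_
      have hxP : x ∈ P := by
        rw [hP']
        intro j hj
        have := hx j hj
        linarith [abs_nonneg R, abs_nonneg (c j₀)]
      have h1 : c j₀ + r * 1 ≤ ⟪N j₀, x⟫ := hx j₀ (Finset.mem_univ j₀)
      have h2 := real_inner_le_norm (N j₀) x
      rw [hN, one_mul] at h2
      linarith [hR x hxP, le_abs_self R, neg_abs_le (c j₀)]
    simp only [hf, this, measureReal_empty]
  obtain ⟨n, g, hg, hg0, hgR, hgp⟩ := (isPolynomialSelection_measureReal_polyhedron d volume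
    finrank_euclideanSpace_fin hbd (fun _ => 1) c).exists_partition hsmooth.continuous
    (R := 1 + |R| + |c j₀|) (by positivity)
  have hg_nonneg : ∀ i, 0 ≤ g i := fun i => hg0 ▸ hg.monotone (Fin.zero_le i)
  refine ⟨n, g, hg, hg0, fun i => ?_, fun r hr => ?_⟩
  · obtain ⟨p, hp, hpf⟩ := hgp i
    refine ⟨Polynomial.C (volume.real P) - p, ?_, fun r hr => ?_⟩
    · exact (Polynomial.natDegree_sub_le _ _).trans (by simpa using hp)
    · rw [hVP r ((hg_nonneg _).trans hr.1), Polynomial.eval_sub, Polynomial.eval_C, ← hpf r hr]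
  · rw [hVP r ((hg_nonneg _).trans hr), hVP _ (hg_nonneg _), hzero _ hgR.ge,
      hzero _ (hgR ▸ hr)]
end

section
/- Let P be a polytope in ℝ^d. The inner neighborhood volume function V_P is a diphase Steiner-like function of class C^{d−1} on [0,+∞) if and only if P admits an inscribed Euclidean d-dimensional ball (a ball contained in P tangent to every facet of P). Moreover, in this case the polynomial coefficients satisfy κ_i(P) = (−1)^{d−i−1} · C(d,i) · vol_d(P) / g^{d−i} for all i = 0, 1, …, d−1, where g is the inradius of P and C(d,i) is a binomial coefficient. -/
open MeasureTheory Metric Set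
open scoped RealInnerProductSpace

/-- The inradius of `P`: the largest `r` such that `P` contains a closed ball of radius `r`. -/
noncomputable def inradius {d : ℕ} (P : Set (EuclideanSpace ℝ (Fin d))) : ℝ :=
  sSup {r : ℝ | ∃ x, closedBall x r ⊆ P}

/-- The body cut out by the half-spaces `c j ≤ ⟪x, N j⟫` after moving each of them inwards by `r`. -/
def offsetBody {E ι : Type*} [NormedAddCommGroup E] [InnerProductSpace ℝ E]
    (N : ι → E) (c : ι → ℝ) (r : ℝ) : Set E :=
  {x | ∀ j, c j + r ≤ ⟪x, N j⟫}

section OffsetBody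

variable {E ι : Type*} [NormedAddCommGroup E] [InnerProductSpace ℝ E]
  {N : ι → E} {c : ι → ℝ} {r s : ℝ} {x O : E}

lemma offsetBody_anti (h : r ≤ s) : offsetBody N c s ⊆ offsetBody N c r :=
  fun _ hx j => by linarith [hx j]

lemma isClosed_offsetBody : IsClosed (offsetBody N c r) := by
  simp only [offsetBody, ofPred_forall]
  exact isClosed_iInter fun j => isClosed_le (by fun_prop) (by fun_prop)

lemma ball_subset_offsetBody (hN : ∀ j, ‖N j‖ = 1) (hx : x ∈ offsetBody N c (s + r)) :
    ball x r ⊆ offsetBody N c s := by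
  intro y hy j
  have h1 := abs_real_inner_le_norm (y - x) (N j)
  rw [hN j, mul_one, ← dist_eq_norm, inner_sub_left] at h1
  linarith [hx j, neg_abs_le (⟪y, N j⟫ - ⟪x, N j⟫), mem_ball.1 hy]

lemma mem_offsetBody_of_ball_subset (hN : ∀ j, ‖N j‖ = 1) (hr : 0 < r)
    (hx : ball x r ⊆ offsetBody N c 0) : x ∈ offsetBody N c r := by
  intro j
  suffices r ≤ ⟪x, N j⟫ - c j by linarith
  refine le_of_forall_lt_imp_le_of_dense fun t ht => ?_
  rcases le_or_gt t 0 with ht0 | ht0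
  · have := hx (mem_ball_self hr) j
    linarith
  · have hy : x - t • N j ∈ ball x r := by
      simpa [mem_ball, dist_eq_norm, norm_smul, hN j, abs_of_pos ht0] using ht
    have := hx hy j
    rw [inner_sub_left, real_inner_smul_left, real_inner_self_eq_norm_sq, hN j] at this
    linarith

lemma closedBall_subset_offsetBody_iff (hN : ∀ j, ‖N j‖ = 1) (hr : 0 < r) :
    closedBall x r ⊆ offsetBody N c 0 ↔ x ∈ offsetBody N c r := by
  refine ⟨fun h => mem_offsetBody_of_ball_subset hN hr (ball_subset_closedBall.trans h), fun h => ?_⟩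
  rw [← closure_ball x hr.ne']
  exact closure_minimal (ball_subset_offsetBody hN (by simpa using h)) isClosed_offsetBody

lemma homothety_image_subset_offsetBody (hO : O ∈ offsetBody N c s) {t : ℝ}
    (ht0 : 0 ≤ t) (ht1 : t ≤ 1) :
    AffineMap.homothety O t '' offsetBody N c r ⊆ offsetBody N c (t * r + (1 - t) * s) := by
  rintro _ ⟨y, hy, rfl⟩ j
  simp only [AffineMap.homothety_apply, vsub_eq_sub, vadd_eq_add, inner_add_left,
    real_inner_smul_left, inner_sub_left]
  nlinarith [mul_le_mul_of_nonneg_left (hy j) ht0,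
    mul_le_mul_of_nonneg_left (hO j) (sub_nonneg.2 ht1)]

lemma homothety_image_offsetBody_subset (hO : ∀ j, ⟪O, N j⟫ - c j = s) {t : ℝ} (ht : 0 ≤ t) :
    AffineMap.homothety O t '' offsetBody N c r ⊆ offsetBody N c (t * r + (1 - t) * s) := by
  rintro _ ⟨y, hy, rfl⟩ j
  simp only [AffineMap.homothety_apply, vsub_eq_sub, vadd_eq_add, inner_add_left,
    real_inner_smul_left, inner_sub_left]
  nlinarith [mul_le_mul_of_nonneg_left (hy j) ht, hO j]

lemma homothety_image_offsetBody_eq (hO : ∀ j, ⟪O, N j⟫ - c j = s) {t : ℝ} (ht : 0 < t) :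
    AffineMap.homothety O t '' offsetBody N c r = offsetBody N c (t * r + (1 - t) * s) := by
  refine (homothety_image_offsetBody_subset hO ht.le).antisymm fun y hy => ?_
  refine ⟨AffineMap.homothety O t⁻¹ y, ?_, ?_⟩
  · have := homothety_image_offsetBody_subset hO (inv_pos.2 ht).le (mem_image_of_mem _ hy)
    convert this using 2
    field_simp
    ring
  · rw [← AffineMap.homothety_mul_apply, mul_inv_cancel₀ ht.ne', AffineMap.homothety_one]
    rfl

/-- If some point violates only the `j`-th constraint of a body with an interior point, then some
point lies on the boundary hyperplane of the `j`-th half-space and strictly inside all others. -/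
lemma exists_mem_facet {j : ι} (hr : 0 < r) (hx : x ∈ offsetBody N c r) {z : E}
    (hz : ∀ i, i ≠ j → c i ≤ ⟪z, N i⟫) (hzj : ⟪z, N j⟫ < c j) :
    ∃ p, ⟪p, N j⟫ = c j ∧ ∀ i, i ≠ j → c i < ⟪p, N i⟫ := by
  have hxj := hx j
  have hD : 0 < ⟪x, N j⟫ - ⟪z, N j⟫ := by linarith
  set l := (⟪x, N j⟫ - c j) / (⟪x, N j⟫ - ⟪z, N j⟫) with hl
  have hl0 : 0 < l := div_pos (by linarith) hD
  have hl1 : l < 1 := (div_lt_one hD).2 (by linarith)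
  refine ⟨x + l • (z - x), ?_, fun i hi => ?_⟩
  · rw [inner_add_left, real_inner_smul_left, inner_sub_left, hl]
    field_simp
    ring
  · rw [inner_add_left, real_inner_smul_left, inner_sub_left]
    nlinarith [mul_le_mul_of_nonneg_left (hz i hi) hl0.le,
      mul_le_mul_of_nonneg_left (hx i) (sub_pos.2 hl1).le, mul_pos hr (sub_pos.2 hl1)]

lemma mem_offsetBody_iff_infDist (hN : ∀ j, ‖N j‖ = 1)
    (hne : (frontier (offsetBody N c 0)).Nonempty) (hr : 0 ≤ r) :
    x ∈ offsetBody N c r ↔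
      x ∈ offsetBody N c 0 ∧ r ≤ infDist x (frontier (offsetBody N c 0)) := by
  rcases hr.eq_or_lt with rfl | hr
  · simp [infDist_nonneg]
  refine ⟨fun hx => ⟨offsetBody_anti hr.le hx, (le_infDist hne).2 fun y hy => ?_⟩, fun ⟨hx, h⟩ => ?_⟩
  · by_contra! hlt
    exact hy.2 (interior_maximal (ball_subset_offsetBody hN (by simpa using hx)) isOpen_ball
      (mem_ball'.2 hlt))
  · have hdisj : ∀ y ∈ ball x r, y ∉ frontier (offsetBody N c 0) := fun y hy hyf =>
      (((le_infDist hne).1 h hyf).trans_lt (mem_ball'.1 hy)).false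
    have hmem : ∀ y ∈ ball x r, y ∈ offsetBody N c 0 → y ∈ interior (offsetBody N c 0) :=
      fun y hy hyP => by
        by_contra hyi
        exact hdisj y hy ⟨subset_closure hyP, hyi⟩
    refine mem_offsetBody_of_ball_subset hN hr (Subset.trans ?_ interior_subset)
    refine (convex_ball x r).isPreconnected.subset_left_of_subset_union isOpen_interior
      isClosed_offsetBody.isOpen_compl (disjoint_compl_right.mono_left interior_subset)
      (fun y hy => ?_) ⟨x, mem_ball_self hr, hmem x (mem_ball_self hr) hx⟩
    by_cases hyP : y ∈ offsetBody N c 0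
    · exact Or.inl (hmem y hy hyP)
    · exact Or.inr hyP

end OffsetBody

section Calculus

open Polynomial Topology

lemma iteratedDeriv_polynomial_eval (p : ℝ[X]) (k : ℕ) :
    iteratedDeriv k (fun x => p.eval x) = fun x => (derivative^[k] p).eval x := by
  induction k with
  | zero => simp
  | succ k ih =>
    rw [iteratedDeriv_succ, ih, Function.iterate_succ_apply']
    ext x
    exact Polynomial.deriv _

/-- If a polynomial of degree at most `n + 1` on `[0, g]` glues with class `C^n` to the zero function on
`[g, ∞)`, then it is a multiple of `(X - g)^(n+1)`. -/
lemma exists_eq_C_mul_of_contDiffOn {n : ℕ} {W : ℝ → ℝ} {p : ℝ[X]} {g : ℝ} (hg : 0 < g)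
    (hdeg : p.natDegree ≤ n + 1) (hW : ContDiffOn ℝ n W (Ici 0))
    (hp : EqOn W (fun x => p.eval x) (Icc 0 g)) (h0 : ∀ r, g ≤ r → W r = 0) :
    ∃ a, p = C a * (X - C g) ^ (n + 1) := by
  rcases eq_or_ne p 0 with rfl | hp0
  · exact ⟨0, by simp⟩
  have hroot : ∀ k ≤ n, (derivative^[k] p).IsRoot g := by
    intro k hk
    have hcont : ContinuousAt (iteratedDeriv k W) g := by
      have h := (hW.mono Ioi_subset_Ici_self).continuousOn_iteratedDerivWithin
        (m := k) (by exact_mod_cast hk) isOpen_Ioi.uniqueDiffOn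
      exact (h.congr (iteratedDerivWithin_of_isOpen isOpen_Ioi).symm).continuousAt
        (Ioi_mem_nhds hg)
    have hleft : EqOn (iteratedDeriv k W) (fun x => (derivative^[k] p).eval x) (Ioo 0 g) := by
      rw [← iteratedDeriv_polynomial_eval]
      exact (hp.mono Ioo_subset_Icc_self).iteratedDeriv_of_isOpen isOpen_Ioo k
    have hright : EqOn (iteratedDeriv k W) (fun _ => 0) (Ioi g) := by
      have : EqOn W (fun x => (0 : ℝ[X]).eval x) (Ioi g) := fun r hr => by
        simpa using h0 r (le_of_lt hr)
      have := this.iteratedDeriv_of_isOpen isOpen_Ioi k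
      rw [iteratedDeriv_polynomial_eval] at this
      simpa using this
    have h1 : iteratedDeriv k W g = (derivative^[k] p).eval g :=
      tendsto_nhds_unique_of_eventuallyEq (l := 𝓝[<] g) (hcont.mono_left nhdsWithin_le_nhds)
        ((derivative^[k] p).continuous.continuousAt.mono_left nhdsWithin_le_nhds)
        (Filter.mem_of_superset (Ioo_mem_nhdsLT hg) hleft)
    have h2 : iteratedDeriv k W g = 0 :=
      tendsto_nhds_unique_of_eventuallyEq (l := 𝓝[>] g) (hcont.mono_left nhdsWithin_le_nhds)
        tendsto_const_nhds (Filter.mem_of_superset self_mem_nhdsWithin hright)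
    exact h1.symm.trans h2
  have hdvd : (X - C g) ^ (n + 1) ∣ p :=
    (le_rootMultiplicity_iff hp0).1 (lt_rootMultiplicity_of_isRoot_iterate_derivative hp0 hroot)
  obtain ⟨q, rfl⟩ := hdvd
  have hq : q.natDegree = 0 := by
    rw [(monic_X_sub_C g).pow (n + 1) |>.natDegree_mul' (right_ne_zero_of_mul hp0),
      natDegree_pow, natDegree_X_sub_C] at hdeg
    omega
  obtain ⟨a, rfl⟩ := natDegree_eq_zero.1 hq
  exact ⟨a, mul_comm _ _⟩

lemma hasDerivAt_max_zero_pow (n : ℕ) (x : ℝ) :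
    HasDerivAt (fun t : ℝ => max t 0 ^ (n + 2)) ((n + 2) * max x 0 ^ (n + 1)) x := by
  have hpow := hasDerivAt_pow (n + 2) x
  rcases lt_trichotomy x 0 with hx | rfl | hx
  · refine HasDerivAt.congr_of_eventuallyEq (f := fun _ => 0) ?_ ?_
    · simpa [max_eq_right hx.le] using hasDerivAt_const x (0 : ℝ)
    · filter_upwards [Iio_mem_nhds hx] with t ht
      simp [max_eq_right (mem_Iio.1 ht).le]
  · rw [← hasDerivWithinAt_univ, ← Iic_union_Ici (a := (0 : ℝ))]
    refine HasDerivWithinAt.union ?_ ?_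
    · refine HasDerivWithinAt.congr (f := fun _ => 0) ?_ ?_ (by simp)
      · simpa using hasDerivWithinAt_const (0 : ℝ) (Iic 0) (0 : ℝ)
      · intro t ht
        simp [max_eq_right (show t ≤ 0 from ht)]
    · refine HasDerivWithinAt.congr (f := fun t => t ^ (n + 2)) ?_ ?_ (by simp)
      · simpa using hpow.hasDerivWithinAt
      · intro t ht
        simp [max_eq_left (show 0 ≤ t from ht)]
  · refine HasDerivAt.congr_of_eventuallyEq (f := fun t => t ^ (n + 2)) ?_ ?_
    · simpa [max_eq_left hx.le] using hpow
    · filter_upwards [Ioi_mem_nhds hx] with t ht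
      simp [max_eq_left (mem_Ioi.1 ht).le]

lemma contDiff_max_zero_pow (n : ℕ) : ContDiff ℝ n (fun t : ℝ => max t 0 ^ (n + 1)) := by
  induction n with
  | zero => exact contDiff_zero.2 (by fun_prop)
  | succ n ih =>
    push_cast
    refine contDiff_succ_iff_deriv.2
      ⟨fun x => (hasDerivAt_max_zero_pow n x).differentiableAt, by simp, ?_⟩
    rw [funext fun x => (hasDerivAt_max_zero_pow n x).deriv]
    exact contDiff_const.mul ih

end Calculus

section Volume

open Topology

variable {d : ℕ} {ι : Type*} {N : ι → EuclideanSpace ℝ (Fin d)} {c : ι → ℝ} {r g : ℝ}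
  {O : EuclideanSpace ℝ (Fin d)}

lemma volume_real_homothety_image {t : ℝ} (ht : 0 ≤ t) (s : Set (EuclideanSpace ℝ (Fin d))) :
    volume.real (AffineMap.homothety O t '' s) = t ^ d * volume.real s := by
  rw [measureReal_def, Measure.addHaar_image_homothety, ENNReal.toReal_mul,
    finrank_euclideanSpace_fin, abs_of_nonneg (pow_nonneg ht d),
    ENNReal.toReal_ofReal (pow_nonneg ht d), measureReal_def]

lemma isCompact_offsetBody (hK : IsCompact (offsetBody N c 0)) (hr : 0 ≤ r) :
    IsCompact (offsetBody N c r) :=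
  hK.of_isClosed_subset isClosed_offsetBody (offsetBody_anti hr)

lemma frontier_nonempty_of_isCompact (hd : 0 < d) {K : Set (EuclideanSpace ℝ (Fin d))}
    (hK : IsCompact K) (hne : K.Nonempty) : (frontier K).Nonempty := by
  have : Nonempty (Fin d) := ⟨⟨0, hd⟩⟩
  exact nonempty_frontier_iff.2 ⟨hne, hK.ne_univ⟩

lemma innerInterior_offsetBody (hd : 0 < d) (hN : ∀ j, ‖N j‖ = 1)
    (hK : IsCompact (offsetBody N c 0)) (hr : 0 ≤ r) :
    innerInterior (offsetBody N c 0) r = offsetBody N c r := by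
  rcases (offsetBody N c 0).eq_empty_or_nonempty with h | h
  · have hr0 : offsetBody N c r = ∅ := subset_empty_iff.1 (h ▸ offsetBody_anti hr)
    simp [innerInterior, h, hr0]
  · ext x
    exact (mem_offsetBody_iff_infDist hN (frontier_nonempty_of_isCompact hd hK h) hr).symm

lemma VP_offsetBody (hd : 0 < d) (hN : ∀ j, ‖N j‖ = 1)
    (hK : IsCompact (offsetBody N c 0)) (hr : 0 ≤ r) :
    VP (offsetBody N c 0) r =
      volume.real (offsetBody N c 0) - volume.real (offsetBody N c r) := by
  rw [VP, innerInterior_offsetBody hd hN hK hr]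
  exact measureReal_sdiff (offsetBody_anti hr) isClosed_offsetBody.measurableSet
    hK.measure_ne_top

/-- A deepest point of the body lies in every nonempty offset, and large offsets are empty. -/
lemma exists_mem_offsetBody_of_nonempty (hd : 0 < d) (hN : ∀ j, ‖N j‖ = 1)
    (hK : IsCompact (offsetBody N c 0)) (hne : (offsetBody N c 0).Nonempty) :
    ∃ O R, ∀ r, 0 ≤ r → (offsetBody N c r).Nonempty → O ∈ offsetBody N c r ∧ r ≤ R := by
  have hf := frontier_nonempty_of_isCompact hd hK hne
  obtain ⟨O, hO, hmax⟩ := hK.exists_isMaxOn hne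
    (continuous_infDist_pt (frontier (offsetBody N c 0))).continuousOn
  refine ⟨O, infDist O (frontier (offsetBody N c 0)), fun r hr ⟨x, hx⟩ => ?_⟩
  obtain ⟨hxK, hxr⟩ := (mem_offsetBody_iff_infDist hN hf hr).1 hx
  have := hxr.trans (hmax hxK)
  exact ⟨(mem_offsetBody_iff_infDist hN hf hr).2 ⟨hO, this⟩, this⟩

lemma volume_real_offsetBody_inradius (hd : 0 < d) (hO : ∀ j, ⟪O, N j⟫ - c j = g) :
    volume.real (offsetBody N c g) = 0 := by
  have h := volume_real_homothety_image (O := O) zero_le_two (offsetBody N c g)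
  rw [homothety_image_offsetBody_eq hO two_pos, show (2 * g + (1 - 2) * g) = g by ring] at h
  have h2 : (1 : ℝ) < 2 ^ d := one_lt_pow₀ one_lt_two hd.ne'
  nlinarith [h, h2]

lemma volume_real_offsetBody (hd : 0 < d) (hK : IsCompact (offsetBody N c 0)) (hg : 0 < g)
    (hO : ∀ j, ⟪O, N j⟫ - c j = g) :
    volume.real (offsetBody N c r) =
      max (1 - r / g) 0 ^ d * volume.real (offsetBody N c 0) := by
  rcases lt_or_ge r g with h | h
  · have ht : 0 < 1 - r / g := sub_pos.2 ((div_lt_one hg).2 h)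
    rw [max_eq_left ht.le, ← volume_real_homothety_image (O := O) ht.le,
      homothety_image_offsetBody_eq hO ht]
    congr 2
    field_simp
    ring
  · rw [max_eq_right (sub_nonpos.2 ((one_le_div hg).2 h)), zero_pow hd.ne', zero_mul]
    refine le_antisymm ?_ measureReal_nonneg
    rw [← volume_real_offsetBody_inradius hd hO]
    exact measureReal_mono (offsetBody_anti h) (isCompact_offsetBody hK hg.le).measure_ne_top

lemma inradius_offsetBody (hd : 0 < d) (hN : ∀ j, ‖N j‖ = 1)
    (hK : IsCompact (offsetBody N c 0)) (hg : 0 < g) (hO : ∀ j, ⟪O, N j⟫ - c j = g) :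
    inradius (offsetBody N c 0) = g := by
  refine IsGreatest.csSup_eq ⟨⟨O, ?_⟩, fun r ⟨x, hx⟩ => ?_⟩
  · exact (closedBall_subset_offsetBody_iff hN hg).2 fun j => by linarith [hO j]
  · by_contra! hlt
    have hball : ball x (r - g) ⊆ offsetBody N c g := ball_subset_offsetBody hN <| by
      simpa using (closedBall_subset_offsetBody_iff hN (hg.trans hlt)).1 hx
    have hpos : 0 < volume.real (ball x (r - g)) :=
      ENNReal.toReal_pos (measure_ball_pos _ _ (sub_pos.2 hlt)).ne' measure_ball_lt_top.ne
    have := measureReal_mono (μ := volume) hball (isCompact_offsetBody hK hg.le).measure_ne_top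
    linarith [volume_real_offsetBody_inradius hd hO]

/-- Near a facet whose hyperplane is at distance more than `g` from `O`, small offsets contain an open
set missed by the homothetic copy of the body centred at `O`. -/
lemma exists_isOpen_disjoint_homothety_image [Finite ι] {p : EuclideanSpace ℝ (Fin d)} {j : ι}
    (hN : ‖N j‖ = 1) (hg : 0 < g) (hOj : g < ⟪O, N j⟫ - c j) (hpj : ⟪p, N j⟫ = c j)
    (hp : ∀ i, i ≠ j → c i < ⟪p, N i⟫) :
    ∃ r ∈ Ioo 0 g, ∃ U : Set (EuclideanSpace ℝ (Fin d)), IsOpen U ∧ U.Nonempty ∧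
      U ⊆ offsetBody N c r ∧
      Disjoint (AffineMap.homothety O (1 - r / g) '' offsetBody N c 0) U := by
  set k := (⟪O, N j⟫ - c j) / g with hk
  have hk1 : 1 < k := (one_lt_div hg).2 hOj
  have hev : ∀ᶠ r in 𝓝[>] (0 : ℝ), r < g ∧ 0 < r ∧
      ∀ i, i ≠ j → c i + r < ⟪p + ((1 + k) / 2 * r) • N j, N i⟫ := by
    have hlt : ∀ᶠ r in 𝓝[>] (0 : ℝ), r < g := nhdsWithin_le_nhds (Iio_mem_nhds hg)
    refine hlt.and
      (Filter.Eventually.and self_mem_nhdsWithin (Filter.eventually_all.2 fun i => ?_))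
    by_cases hi : i = j
    · exact Filter.Eventually.of_forall fun r h => (h hi).elim
    · have hcont : Continuous fun r : ℝ => ⟪p + ((1 + k) / 2 * r) • N j, N i⟫ - (c i + r) := by
        fun_prop
      have := (hcont.tendsto 0).eventually_const_lt (u := 0) (by simpa using hp i hi)
      filter_upwards [nhdsWithin_le_nhds this] with r hr _
      linarith
  obtain ⟨r, hrg, hr0, hr⟩ := hev.exists
  refine ⟨r, ⟨hr0, hrg⟩, {x | (c j + r < ⟪x, N j⟫ ∧ ⟪x, N j⟫ < c j + k * r) ∧
    ∀ i, i ≠ j → c i + r < ⟪x, N i⟫}, ?_, ⟨p + ((1 + k) / 2 * r) • N j, ?_, hr⟩, ?_, ?_⟩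
  · refine IsOpen.and (IsOpen.and ?_ ?_) ?_
    · exact isOpen_lt (by fun_prop) (by fun_prop)
    · exact isOpen_lt (by fun_prop) (by fun_prop)
    · simp only [ofPred_forall]
      exact isOpen_iInter_of_finite fun i => isOpen_iInter_of_finite fun _ =>
        isOpen_lt (by fun_prop) (by fun_prop)
  · rw [inner_add_left, real_inner_smul_left, real_inner_self_eq_norm_sq, hN, hpj]
    constructor <;> nlinarith
  · rintro x ⟨⟨h1, -⟩, h2⟩ i
    rcases eq_or_ne i j with rfl | hi
    · exact h1.le
    · exact (h2 i hi).le
  · rw [Set.disjoint_left]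
    rintro _ ⟨y, hy, rfl⟩ ⟨⟨-, h⟩, -⟩
    simp only [AffineMap.homothety_apply, vsub_eq_sub, vadd_eq_add, inner_add_left,
      real_inner_smul_left, inner_sub_left] at h
    have hkr : k * r = r / g * (⟪O, N j⟫ - c j) := by rw [hk]; field_simp
    have ht : 0 ≤ 1 - r / g := sub_nonneg.2 ((div_le_one hg).2 hrg.le)
    nlinarith [mul_le_mul_of_nonneg_left (hy j) ht]

lemma exists_inscribed_of_volume_real [Finite ι] (hd : 0 < d) (hN : ∀ j, ‖N j‖ = 1)
    (hK : IsCompact (offsetBody N c 0)) (hint : (interior (offsetBody N c 0)).Nonempty)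
    (hmin : ∀ j, ∃ z, (∀ i, i ≠ j → c i ≤ ⟪z, N i⟫) ∧ ⟪z, N j⟫ < c j) (hg : 0 < g)
    (hvol : ∀ r ∈ Icc 0 g, volume.real (offsetBody N c r) =
      (1 - r / g) ^ d * volume.real (offsetBody N c 0)) :
    ∃ O, ∀ j, ⟪O, N j⟫ - c j = g := by
  have hpos : 0 < volume.real (offsetBody N c 0) :=
    ENNReal.toReal_pos (Measure.measure_pos_of_nonempty_interior _ hint).ne' hK.measure_ne_top
  obtain ⟨O, _, hO⟩ := exists_mem_offsetBody_of_nonempty hd hN hK (hint.mono interior_subset)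
  have hOr : ∀ r ∈ Ico 0 g, O ∈ offsetBody N c r := fun r hr => by
    refine (hO r hr.1 (nonempty_of_measure_ne_zero (μ := volume) fun h => ?_)).1
    have h1 := hvol r ⟨hr.1, hr.2.le⟩
    rw [measureReal_def, h, ENNReal.toReal_zero] at h1
    have : 0 < 1 - r / g := sub_pos.2 ((div_lt_one hg).2 hr.2)
    exact (mul_pos (pow_pos this d) hpos).ne h1
  have hOg : O ∈ offsetBody N c g := fun j => by
    suffices g ≤ ⟪O, N j⟫ - c j by linarith
    refine le_of_forall_lt_imp_le_of_dense fun t ht => ?_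
    have := hOr (max t 0) ⟨le_max_right _ _, max_lt ht hg⟩ j
    linarith [le_max_left t 0]
  refine ⟨O, fun j => le_antisymm (not_lt.1 fun hj => ?_) (by linarith [hOg j])⟩
  obtain ⟨z, hz, hzj⟩ := hmin j
  obtain ⟨p, hpj, hp⟩ := exists_mem_facet hg hOg hz hzj
  obtain ⟨r, ⟨hr0, hrg⟩, U, hUo, hUne, hU, hdisj⟩ :=
    exists_isOpen_disjoint_homothety_image (hN j) hg hj hpj hp
  have ht0 : 0 ≤ 1 - r / g := sub_nonneg.2 ((div_le_one hg).2 hrg.le)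
  have hA : AffineMap.homothety O (1 - r / g) '' offsetBody N c 0 ⊆ offsetBody N c r := by
    have := homothety_image_subset_offsetBody (r := 0) hOg ht0 (by linarith [div_pos hr0 hg])
    rwa [show (1 - r / g) * 0 + (1 - (1 - r / g)) * g = r by field_simp; ring] at this
  have hfin := (isCompact_offsetBody (N := N) (c := c) hK hr0.le).measure_ne_top (μ := volume)
  have hunion := measureReal_union (μ := volume) hdisj hUo.measurableSet
    (measure_ne_top_of_subset hA hfin) (measure_ne_top_of_subset hU hfin)
  have hle := measureReal_mono (union_subset hA hU) hfin
  have hUpos : 0 < volume.real U := ENNReal.toReal_pos (hUo.measure_pos volume hUne).ne'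
    (measure_ne_top_of_subset hU hfin)
  rw [volume_real_homothety_image ht0] at hunion
  linarith [hvol r ⟨hr0.le, hrg.le⟩]

open Polynomial in
lemma exists_polynomial_eq_of_diphase (hd : 0 < d) (hN : ∀ j, ‖N j‖ = 1)
    (hK : IsCompact (offsetBody N c 0)) (hne : (offsetBody N c 0).Nonempty) {κ : Fin d → ℝ}
    (hg : 0 < g)
    (hpoly : ∀ r ∈ Icc (0 : ℝ) g, VP (offsetBody N c 0) r = ∑ i : Fin d, κ i * r ^ (d - (i : ℕ)))
    (hconst : ∀ r, g ≤ r → VP (offsetBody N c 0) r = VP (offsetBody N c 0) g)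
    (hC : ContDiffOn ℝ (d - 1 : ℕ) (VP (offsetBody N c 0)) (Ici 0)) :
    ∃ a, C (volume.real (offsetBody N c 0)) - ∑ i : Fin d, C (κ i) * X ^ (d - (i : ℕ)) =
      C a * (X - C g) ^ d := by
  obtain ⟨n, rfl⟩ : ∃ n, d = n + 1 := ⟨d - 1, by omega⟩
  obtain ⟨_, R, hR⟩ := exists_mem_offsetBody_of_nonempty hd hN hK hne
  have hVg : VP (offsetBody N c 0) g = volume.real (offsetBody N c 0) := by
    have hb : g ≤ max g (R + 1) := le_max_left _ _
    have hempty : offsetBody N c (max g (R + 1)) = ∅ := by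
      by_contra h
      have := (hR _ (hg.le.trans hb) (nonempty_iff_ne_empty.2 h)).2
      linarith [le_max_right g (R + 1)]
    rw [← hconst _ hb, VP_offsetBody hd hN hK (hg.le.trans hb), hempty, measureReal_empty, sub_zero]
  refine exists_eq_C_mul_of_contDiffOn
    (W := fun r => volume.real (offsetBody N c 0) - VP (offsetBody N c 0) r) hg ?_
    (contDiffOn_const.sub hC) (fun r hr => ?_) fun r hr => ?_
  · refine (natDegree_sub_le _ _).trans (max_le (by simp) ?_)
    exact natDegree_sum_le_of_forall_le _ _ fun i _ =>
      (natDegree_C_mul_X_pow_le _ _).trans (Nat.sub_le _ _)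
  · simp [hpoly r hr, eval_finsetSum]
  · simp [hconst r hr, hVg]

open Polynomial in
lemma inscribed_and_coeff_of_diphase [Finite ι] (hd : 0 < d) (hN : ∀ j, ‖N j‖ = 1)
    (hK : IsCompact (offsetBody N c 0)) (hint : (interior (offsetBody N c 0)).Nonempty)
    (hmin : ∀ j, ∃ z, (∀ i, i ≠ j → c i ≤ ⟪z, N i⟫) ∧ ⟪z, N j⟫ < c j) {κ : Fin d → ℝ} (hg : 0 < g)
    (hpoly : ∀ r ∈ Icc (0 : ℝ) g, VP (offsetBody N c 0) r = ∑ i : Fin d, κ i * r ^ (d - (i : ℕ)))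
    (hconst : ∀ r, g ≤ r → VP (offsetBody N c 0) r = VP (offsetBody N c 0) g)
    (hC : ContDiffOn ℝ (d - 1 : ℕ) (VP (offsetBody N c 0)) (Ici 0)) :
    (∃ O, ∀ j, ⟪O, N j⟫ - c j = g) ∧
      ∀ i : Fin d, κ i = (-1 : ℝ) ^ (d - (i : ℕ) - 1) * (d.choose (i : ℕ)) *
        volume.real (offsetBody N c 0) / g ^ (d - (i : ℕ)) := by
  obtain ⟨a, ha⟩ := exists_polynomial_eq_of_diphase hd hN hK (hint.mono interior_subset) hg
    hpoly hconst hC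
  have ha0 : volume.real (offsetBody N c 0) = a * (-g) ^ d := by
    have := congrArg (eval 0) ha
    have hsum : ∑ i : Fin d, κ i * (0 : ℝ) ^ (d - (i : ℕ)) = 0 :=
      Finset.sum_eq_zero fun i _ => by rw [zero_pow (by omega), mul_zero]
    simpa [eval_finsetSum, hsum] using this
  refine ⟨exists_inscribed_of_volume_real hd hN hK hint hmin hg fun r hr => ?_, fun i => ?_⟩
  · have := congrArg (eval r) ha
    simp only [eval_sub, eval_finsetSum, eval_mul, eval_C, eval_pow, eval_X] at this
    rw [← hpoly r hr, VP_offsetBody hd hN hK hr.1, sub_sub_cancel] at this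
    rw [this, ha0, mul_left_comm, ← mul_pow]
    congr 2
    field_simp
    ring
  · have hi := i.isLt
    have := congrArg (coeff · (d - (i : ℕ))) ha
    simp only [coeff_sub, coeff_C_mul, sub_eq_add_neg X (C g), ← C_neg,
      coeff_X_add_C_pow, finsetSum_coeff, coeff_X_pow,
      coeff_C_of_ne_zero (show d - (i : ℕ) ≠ 0 by omega)] at this
    rw [Finset.sum_eq_single i
      (fun b _ hb => by
        have : d - (i : ℕ) ≠ d - (b : ℕ) := fun h => hb (Fin.ext (by omega))
        simp [this]) (by simp), Nat.choose_symm hi.le, Nat.sub_sub_self hi.le] at this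
    obtain ⟨k, hk⟩ : ∃ k, d = i + (k + 1) := ⟨d - i - 1, by omega⟩
    have hk1 : d - (i : ℕ) = k + 1 := by omega
    have hpow : (-g) ^ d = (-g) ^ (i : ℕ) * (-g) ^ (k + 1) := by rw [← pow_add, ← hk]
    rw [ha0, hk1, hpow, eq_div_iff (pow_pos hg _).ne', neg_pow g (k + 1)]
    have hsq : ((-1 : ℝ) ^ k) ^ 2 = 1 := by rw [← pow_mul, mul_comm, pow_mul]; simp
    simp only [if_true, mul_one, zero_sub] at this
    rw [Nat.add_sub_cancel, pow_succ (-1 : ℝ) k]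
    linear_combination (-g ^ (k + 1)) * this +
      (d.choose i * a * (-g) ^ (i : ℕ) * g ^ (k + 1)) * hsq

/-- The expansion of `1 - (1 - r / g) ^ d` in powers of `r`. -/
lemma one_sub_one_sub_div_pow (r g : ℝ) (d : ℕ) :
    1 - (1 - r / g) ^ d = ∑ i : Fin d,
      (-1 : ℝ) ^ (d - (i : ℕ) - 1) * (d.choose (i : ℕ)) / g ^ (d - (i : ℕ)) *
        r ^ (d - (i : ℕ)) := by
  rw [sub_eq_add_neg 1 (r / g), add_pow, Finset.sum_range_succ,
    Finset.sum_range (n := d)]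
  simp only [one_pow, one_mul, Nat.sub_self, pow_zero, Nat.choose_self, Nat.cast_one]
  rw [sub_add_cancel_right, ← Finset.sum_neg_distrib]
  refine Finset.sum_congr rfl fun i _ => ?_
  obtain ⟨k, hk⟩ : ∃ k, d - (i : ℕ) = k + 1 := ⟨d - i - 1, by omega⟩
  rw [hk, Nat.add_sub_cancel, neg_pow, div_pow, pow_succ (-1 : ℝ)]
  ring

lemma diphase_of_inscribed (hd : 0 < d) (hN : ∀ j, ‖N j‖ = 1)
    (hK : IsCompact (offsetBody N c 0)) (hg : 0 < g) (hO : ∀ j, ⟪O, N j⟫ - c j = g) :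
    (∃ κ : Fin d → ℝ,
      (∀ r ∈ Icc (0 : ℝ) g, VP (offsetBody N c 0) r = ∑ i : Fin d, κ i * r ^ (d - (i : ℕ))) ∧
      (∀ r, g ≤ r → VP (offsetBody N c 0) r = VP (offsetBody N c 0) g)) ∧
    ContDiffOn ℝ (d - 1 : ℕ) (VP (offsetBody N c 0)) (Ici 0) := by
  have hV : ∀ r, 0 ≤ r → VP (offsetBody N c 0) r =
      volume.real (offsetBody N c 0) * (1 - max (1 - r / g) 0 ^ d) := fun r hr => by
    rw [VP_offsetBody hd hN hK hr, volume_real_offsetBody (r := r) hd hK hg hO]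
    ring
  refine ⟨⟨fun i => volume.real (offsetBody N c 0) *
    ((-1 : ℝ) ^ (d - (i : ℕ) - 1) * (d.choose (i : ℕ)) / g ^ (d - (i : ℕ))),
    fun r hr => ?_, fun r hr => ?_⟩, ?_⟩
  · rw [hV r hr.1, max_eq_left (sub_nonneg.2 ((div_le_one hg).2 hr.2)),
      one_sub_one_sub_div_pow, Finset.mul_sum]
    simp only [mul_assoc]
  · rw [hV r (hg.le.trans hr), hV g hg.le, div_self hg.ne', sub_self, max_self,
      max_eq_right (sub_nonpos.2 ((one_le_div hg).2 hr))]
  · refine ContDiffOn.congr (ContDiff.contDiffOn ?_) hV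
    obtain ⟨n, rfl⟩ : ∃ n, d = n + 1 := ⟨d - 1, by omega⟩
    refine contDiff_const.mul (contDiff_const.sub ?_)
    exact (contDiff_max_zero_pow n).comp (g := fun t : ℝ => max t 0 ^ (n + 1))
      (f := fun r : ℝ => 1 - r / g) (by fun_prop)

end Volume

/-- `V_P` is a diphase Steiner-like function of class `C^{d-1}` on `[0,∞)`
iff `P` admits an inscribed `d`-dimensional ball; moreover in this case the coefficients are
`κ_i(P) = (-1)^{d-i-1} C(d,i) vol_d(P) / g^{d-i}` where `g` is the inradius. -/
theorem statement2 {d m : ℕ} (hd : 0 < d) (P : Set (EuclideanSpace ℝ (Fin d)))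
    (N : Fin m → EuclideanSpace ℝ (Fin d)) (c : Fin m → ℝ)
    (hN : ∀ j, ‖N j‖ = 1)
    (hP : P = ⋂ j, {x : EuclideanSpace ℝ (Fin d) | c j ≤ ⟪x, N j⟫})
    (hmin : ∀ j : Fin m,
      (⋂ i ∈ Finset.univ.erase j, {x : EuclideanSpace ℝ (Fin d) | c i ≤ ⟪x, N i⟫}) ≠ P)
    (hcomp : IsCompact P)
    (hint : (interior P).Nonempty) :
    (((∃ g₁ > (0 : ℝ), ∃ κ : Fin d → ℝ,
          (∀ r ∈ Icc (0 : ℝ) g₁, VP P r = ∑ i : Fin d, κ i * r ^ (d - (i : ℕ))) ∧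
          (∀ r, g₁ ≤ r → VP P r = VP P g₁)) ∧
        ContDiffOn ℝ (d - 1 : ℕ) (VP P) (Ici 0)) ↔
      (∃ (O : EuclideanSpace ℝ (Fin d)) (ρ : ℝ), 0 < ρ ∧ closedBall O ρ ⊆ P ∧
        ∀ j, ⟪O, N j⟫ - c j = ρ)) ∧
    (∀ (g₁ : ℝ) (κ : Fin d → ℝ), 0 < g₁ →
      (∀ r ∈ Icc (0 : ℝ) g₁, VP P r = ∑ i : Fin d, κ i * r ^ (d - (i : ℕ))) →
      (∀ r, g₁ ≤ r → VP P r = VP P g₁) →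
      ContDiffOn ℝ (d - 1 : ℕ) (VP P) (Ici 0) →
      ∀ i : Fin d, κ i = (-1 : ℝ) ^ (d - (i : ℕ) - 1) * (d.choose (i : ℕ)) *
        (volume P).toReal / (inradius P) ^ (d - (i : ℕ))) := by
  obtain rfl : P = offsetBody N c 0 := by
    rw [hP]
    ext x
    simp [offsetBody]
  have hmin' : ∀ j, ∃ z, (∀ i, i ≠ j → c i ≤ ⟪z, N i⟫) ∧ ⟪z, N j⟫ < c j := fun j => by
    by_contra! h
    refine hmin j ?_
    ext x
    simp only [Finset.mem_erase, Finset.mem_univ, and_true, mem_iInter, mem_ofPred_eq, offsetBody,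
      add_zero]
    refine ⟨fun hx i => ?_, fun hx i _ => hx i⟩
    rcases eq_or_ne i j with rfl | hi
    · exact h x hx
    · exact hx i hi
  refine ⟨⟨?_, ?_⟩, fun g κ hg hpoly hconst hC => ?_⟩
  · rintro ⟨⟨g, hg, κ, hpoly, hconst⟩, hC⟩
    obtain ⟨⟨O, hO⟩, -⟩ :=
      inscribed_and_coeff_of_diphase hd hN hcomp hint hmin' hg hpoly hconst hC
    exact ⟨O, g, hg, (closedBall_subset_offsetBody_iff hN hg).2 fun j => by linarith [hO j], hO⟩
  · rintro ⟨O, g, hg, -, hO⟩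
    obtain ⟨hV, hC⟩ := diphase_of_inscribed hd hN hcomp hg hO
    exact ⟨⟨g, hg, hV⟩, hC⟩
  · obtain ⟨⟨O, hO⟩, hκ⟩ :=
      inscribed_and_coeff_of_diphase hd hN hcomp hint hmin' hg hpoly hconst hC
    rw [inradius_offsetBody hd hN hcomp hg hO]
    exact hκ
end

section
/- Let 𝒜 = {(H_1,v_1), …, (H_m,v_m)} be a gliding d-arrangement of hyperplanes in ℝ^d of first type whose family of unit normals has absolute rank k, and let ε ∈ {±1}^m be a multi-index such that the cell C_ε(t₀) is bounded and has nonzero d-volume for some t₀ ∈ ℝ. Then the function W(t) = vol_d(C_ε(t)) is a piecewise polynomial function of degree at most d on ℝ (with finitely many polynomial pieces), continuous, and of differentiability class C^{k−1} on ℝ. -/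
open MeasureTheory Metric Set
open scoped RealInnerProductSpace

/-- The cell `C_ε(t)` of a gliding `d`-arrangement `{(H_j, v_j)}_j`, where
`H_j = {x | ⟪x - p j, N j⟫ = 0}` and `H_j(t) = {x | ⟪x - p j, N j⟫ = t⟪v j, N j⟫}`. -/
def glidingCell {d m : ℕ} (p N v : Fin m → EuclideanSpace ℝ (Fin d))
    (ε : Fin m → ℝ) (t : ℝ) : Set (EuclideanSpace ℝ (Fin d)) :=
  {x | ∀ j, 0 ≤ ε j * (⟪x - p j, N j⟫ - t * ⟪v j, N j⟫)}

open Filter Topology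

/-- The intersection of the half-spaces `f i x ≤ h i` for `i ∈ S`. -/
def halfspaceInter {ι E : Type*} [NormedAddCommGroup E] [NormedSpace ℝ E]
    (f : ι → E →L[ℝ] ℝ) (S : Finset ι) (h : ι → ℝ) : Set E :=
  {x | ∀ i ∈ S, f i x ≤ h i}

section Halfspaces

variable {ι E : Type*} [NormedAddCommGroup E] [NormedSpace ℝ E]

lemma halfspaceInter_isClosed (f : ι → E →L[ℝ] ℝ) (S : Finset ι) (h : ι → ℝ) :
    IsClosed (halfspaceInter f S h) := by
  simp only [halfspaceInter, Set.ofPred_forall]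
  exact isClosed_biInter fun i _ => isClosed_le (f i).continuous continuous_const

lemma halfspaceInter_mono (f : ι → E →L[ℝ] ℝ) (S : Finset ι) {h h' : ι → ℝ}
    (hh : ∀ i, h i ≤ h' i) : halfspaceInter f S h ⊆ halfspaceInter f S h' :=
  fun _ hx i hi => (hx i hi).trans (hh i)

variable [MeasurableSpace E] [BorelSpace E]

lemma halfspaceInter_measurableSet (f : ι → E →L[ℝ] ℝ) (S : Finset ι) (h : ι → ℝ) :
    MeasurableSet (halfspaceInter f S h) :=
  (halfspaceInter_isClosed f S h).measurableSet

variable [FiniteDimensional ℝ E] (μ : Measure E) [μ.IsAddHaarMeasure]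

lemma measure_hyperplane_eq_zero_s4 {g : E →L[ℝ] ℝ} (hg : g ≠ 0) (c : ℝ) :
    μ {x | g x = c} = 0 := by
  obtain ⟨w, hw⟩ : ∃ w, g w ≠ 0 := by
    by_contra! h
    exact hg (ContinuousLinearMap.ext h)
  have hker : μ (g.ker : Set E) = 0 := by
    refine Measure.addHaar_submodule μ _ fun h => hw ?_
    have : w ∈ g.ker := h ▸ Submodule.mem_top
    simpa using this
  have : {x | g x = c} = (fun x => x + (-(c / g w) • w)) ⁻¹' (g.ker : Set E) := by
    ext x
    simp [hw, add_neg_eq_zero]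
  rw [this, measure_preimage_add_right, hker]

omit [BorelSpace E] in
lemma measure_ne_top_of_isBounded {A : Set E} (hA : Bornology.IsBounded A) : μ A ≠ ⊤ :=
  hA.measure_lt_top.ne

/-- A bounded intersection of half-spaces with positive volume stays bounded when the
half-spaces are translated. -/
lemma halfspaceInter_isBounded {f : ι → E →L[ℝ] ℝ} {S : Finset ι} {h₀ : ι → ℝ}
    (hf : ∀ i ∈ S, f i ≠ 0) (hb : Bornology.IsBounded (halfspaceInter f S h₀))
    (hv : μ (halfspaceInter f S h₀) ≠ 0) (h : ι → ℝ) :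
    Bornology.IsBounded (halfspaceInter f S h) := by
  obtain ⟨x₀, hx₀⟩ : ∃ x₀, ∀ i ∈ S, f i x₀ < h₀ i := by
    have hnull : μ (⋃ i ∈ S, {x | f i x = h₀ i}) = 0 :=
      (measure_biUnion_null_iff S.countable_toSet).2
        fun i hi => measure_hyperplane_eq_zero_s4 μ (hf i hi) _
    by_contra! hne
    refine hv (measure_mono_null (fun x hx => ?_) hnull)
    obtain ⟨i, hi, hle⟩ := hne x
    exact mem_biUnion hi ((hx i hi).antisymm hle)
  obtain ⟨r, hr, hr'⟩ : ∃ r : ℝ, 0 < r ∧ ∀ i ∈ S, f i x₀ + r * h i ≤ h₀ i := by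
    have : ∀ᶠ r : ℝ in 𝓝[>] 0, ∀ i ∈ S, f i x₀ + r * h i ≤ h₀ i := by
      refine (Finset.eventually_all S).2 fun i hi => ?_
      have hc : Tendsto (fun r : ℝ => f i x₀ + r * h i) (𝓝[>] 0) (𝓝 (f i x₀)) := by
        have : Continuous (fun r : ℝ => f i x₀ + r * h i) := by fun_prop
        simpa using (this.tendsto 0).mono_left nhdsWithin_le_nhds
      exact (hc.eventually_lt_const (hx₀ i hi)).mono fun _ => le_of_lt
    obtain ⟨r, h1, h2⟩ := (this.and self_mem_nhdsWithin).exists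
    exact ⟨r, h2, h1⟩
  obtain ⟨R, hR⟩ := hb.exists_norm_le
  refine isBounded_iff_forall_norm_le.2 ⟨r⁻¹ * (R + ‖x₀‖), fun x hx => ?_⟩
  have hmem : x₀ + r • x ∈ halfspaceInter f S h₀ := fun i hi => by
    rw [map_add, map_smul, smul_eq_mul]
    exact (add_le_add_right (mul_le_mul_of_nonneg_left (hx i hi) hr.le) _).trans (hr' i hi)
  have h1 : ‖r • x‖ ≤ R + ‖x₀‖ := by
    have := norm_sub_le (x₀ + r • x) x₀
    rw [add_sub_cancel_left] at this
    linarith [hR _ hmem]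
  rw [norm_smul, Real.norm_of_nonneg hr.le] at h1
  rwa [le_inv_mul_iff₀ hr]

/-- The volume of an intersection of half-spaces depends continuously on their offsets. -/
lemma continuousAt_volume_halfspaceInter [Fintype ι] {f : ι → E →L[ℝ] ℝ} {S : Finset ι}
    (hb : ∀ h, Bornology.IsBounded (halfspaceInter f S h)) {h₀ : ι → ℝ}
    (hf : ∀ i ∈ S, f i = 0 → h₀ i ≠ 0) :
    ContinuousAt (fun h => μ.real (halfspaceInter f S h)) h₀ := by
  refine (ENNReal.tendsto_toReal (measure_ne_top_of_isBounded μ (hb h₀))).comp ?_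
  refine tendsto_measure_of_ae_tendsto_indicator (𝓝 h₀)
    (B := halfspaceInter f S (fun i => h₀ i + 1)) (halfspaceInter_measurableSet f S h₀)
    (fun h => halfspaceInter_measurableSet f S h) (halfspaceInter_measurableSet f S _)
    (measure_ne_top_of_isBounded μ (hb _)) ?_ ?_
  · have : ∀ᶠ h : ι → ℝ in 𝓝 h₀, ∀ i, h i ≤ h₀ i + 1 := eventually_all.2 fun i =>
      ((continuous_apply i).tendsto h₀).eventually_le_const (by linarith)
    exact this.mono fun h hh => halfspaceInter_mono f S hh
  · have hne : ∀ᵐ x ∂μ, ∀ i ∈ S, f i x ≠ h₀ i := by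
      refine (ae_ball_iff S.countable_toSet).2 fun i hi => ?_
      by_cases h0 : f i = 0
      · exact ae_of_all _ fun x => by simpa [h0] using (hf i hi h0).symm
      · simpa [ae_iff, -Set.ofPred_eq_eq_singleton] using measure_hyperplane_eq_zero_s4 μ h0 (h₀ i)
    filter_upwards [hne] with x hx
    have : ∀ᶠ h : ι → ℝ in 𝓝 h₀, ∀ i ∈ S, (f i x ≤ h i ↔ f i x ≤ h₀ i) := by
      refine (Finset.eventually_all S).2 fun i hi => ?_
      have ht := (continuous_apply i).tendsto h₀
      rcases (hx i hi).lt_or_gt with hlt | hgt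
      · exact (ht.eventually_const_lt hlt).mono fun h hh => iff_of_true hh.le hlt.le
      · exact (ht.eventually_lt_const hgt).mono fun h hh => iff_of_false hh.not_ge hgt.not_ge
    exact this.mono fun h hh => forall₂_congr hh

/-- Disintegration of a Haar measure along a nonzero linear functional. -/
lemma exists_disintegration {g : E →L[ℝ] ℝ} (hg : g ≠ 0) :
    ∃ (w : E) (ν : Measure g.ker), g w = 1 ∧ ν.IsAddHaarMeasure ∧
      MeasurePreserving (fun y : ℝ × g.ker => y.1 • w + (y.2 : E)) (volume.prod ν) μ := by
  obtain ⟨w, hw⟩ : ∃ w, g w = 1 := by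
    obtain ⟨w, hw⟩ : ∃ w, g w ≠ 0 := by
      by_contra! h
      exact hg (ContinuousLinearMap.ext h)
    exact ⟨(g w)⁻¹ • w, by simp [hw]⟩
  let e := (ContinuousLinearEquiv.equivOfRightInverse g (ContinuousLinearMap.toSpanSingleton ℝ w)
    (fun s => by simp [hw])).symm
  let ν₀ : Measure g.ker := Measure.addHaar
  let μ' : Measure E := (volume.prod ν₀).map e
  have : μ'.IsAddHaarMeasure := e.isAddHaarMeasure_map _
  have hμ := Measure.isAddLeftInvariant_eq_smul μ μ'
  set c := Measure.addHaarScalarFactor μ μ' with hc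
  have hc0 : c ≠ 0 := (Measure.addHaarScalarFactor_pos_of_isAddHaarMeasure μ μ').ne'
  refine ⟨w, c • ν₀, hw, ?_, ?_⟩
  · exact Measure.IsAddHaarMeasure.nnreal_smul ν₀ hc0
  · refine ⟨by fun_prop, ?_⟩
    rw [hμ, Measure.prod_smul_right, Measure.map_smul]
    rfl

end Halfspaces

/-- A function on `ℝ^ι` whose partial derivatives exist near a point and are continuous there is
differentiable at that point. -/
lemma hasFDerivAt_of_partial {ι : Type*} [Fintype ι] [DecidableEq ι] {V : (ι → ℝ) → ℝ}
    {G : ι → (ι → ℝ) → ℝ} {h₀ : ι → ℝ}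
    (hG : ∀ i, ∀ᶠ h in 𝓝 h₀, HasDerivAt (fun s => V (Function.update h i s)) (G i h) (h i))
    (hc : ∀ i, ContinuousAt (G i) h₀) :
    HasFDerivAt V (∑ i, G i h₀ • ContinuousLinearMap.proj (R := ℝ) (φ := fun _ : ι => ℝ) i) h₀ := by
  have key : ∀ s : Finset ι,
      (fun h => V (s.piecewise h h₀) - V h₀ - ∑ i ∈ s, G i h₀ * (h i - h₀ i))
        =o[𝓝 h₀] fun h => h - h₀ := by
    intro s
    induction s using Finset.induction_on with
    | empty => simp
    | insert j s hj ih =>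
      have hupd : Tendsto (fun p : (ι → ℝ) × ℝ => Function.update (s.piecewise p.1 h₀) j p.2)
          (𝓝 h₀ ×ˢ 𝓝 (h₀ j)) (𝓝 h₀) := by
        rw [← nhds_prod_eq]
        have hcont : Continuous
            (fun p : (ι → ℝ) × ℝ => Function.update (s.piecewise p.1 h₀) j p.2) := by
          refine Continuous.update (continuous_pi fun i => ?_) j continuous_snd
          by_cases hi : i ∈ s
          · simp only [hi, Finset.piecewise_eq_of_mem]
            fun_prop
          · simp only [hi, not_false_eq_true, Finset.piecewise_eq_of_notMem]
            fun_prop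
        simpa [Finset.piecewise_same] using hcont.tendsto (h₀, h₀ j)
      have hstep : (fun h : ι → ℝ => V (Function.update (s.piecewise h h₀) j (h j)) -
          V (Function.update (s.piecewise h h₀) j (h₀ j)) - G j h₀ * (h j - h₀ j))
            =o[𝓝 h₀] fun h => h j - h₀ j := by
        rw [Asymptotics.isLittleO_iff]
        intro c hcpos
        have hnear : ∀ᶠ h in 𝓝 h₀, ‖G j h - G j h₀‖ ≤ c := by
          filter_upwards [(hc j).eventually (Metric.closedBall_mem_nhds _ hcpos)] with h hh
          simpa [dist_eq_norm] using hh
        obtain ⟨pa, hpa, pb, hpb, hp⟩ :=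
          eventually_prod_iff.1 (hupd.eventually ((hG j).and hnear))
        obtain ⟨r, hr, hball⟩ := Metric.eventually_nhds_iff_ball.1 hpb
        have hin := ((continuous_apply j).tendsto h₀).eventually (Metric.ball_mem_nhds _ hr)
        filter_upwards [hpa, hin] with h hh hhj
        have := Convex.norm_image_sub_le_of_norm_hasDerivWithin_le
          (f := fun x => V (Function.update (s.piecewise h h₀) j x) - G j h₀ * x)
          (f' := fun x => G j (Function.update (s.piecewise h h₀) j x) - G j h₀)
          (s := Metric.ball (h₀ j) r) (C := c)
          (fun x hx => by
            have h1 := (hp hh (hball x hx)).1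
            simp only [Function.update_idem, Function.update_self] at h1
            simpa using (h1.fun_sub ((hasDerivAt_id' x).const_mul (G j h₀))).hasDerivWithinAt)
          (fun x hx => (hp hh (hball x hx)).2) (convex_ball _ _)
          (Metric.mem_ball_self hr) hhj
        refine le_of_eq_of_le (congrArg norm ?_) this
        ring
      have hle : (fun h : ι → ℝ => h j - h₀ j) =O[𝓝 h₀] fun h => h - h₀ :=
        Asymptotics.isBigO_of_le _ fun h => norm_le_pi_norm (h - h₀) j
      refine ((hstep.trans_isBigO hle).add ih).congr_left fun h => ?_
      have hself : Function.update (s.piecewise h h₀) j (h₀ j) = s.piecewise h h₀ := by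
        conv_rhs => rw [← Function.update_eq_self j (s.piecewise h h₀)]
        simp [hj]
      rw [Finset.piecewise_insert, Finset.sum_insert hj, hself]
      ring
  rw [hasFDerivAt_iff_isLittleO]
  refine (key Finset.univ).congr_left fun h => ?_
  simp

section Derivative

variable {ι E : Type*} [NormedAddCommGroup E] [NormedSpace ℝ E] [FiniteDimensional ℝ E]

/-- The offsets, along `f i = h i`, of the traces of the other hyperplanes. -/
noncomputable def sectionOffsets (f : ι → E →L[ℝ] ℝ) (w : E) (j : ι) (h : ι → ℝ) : ι → ℝ :=
  fun i => h i - h j * f i w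

/-- The restrictions of the functionals to the kernel of `f j`. -/
noncomputable def sectionFunctionals (f : ι → E →L[ℝ] ℝ) (j : ι) (i : ι) :
    (f j).ker →L[ℝ] ℝ :=
  (f i).comp (f j).ker.subtypeL

variable [DecidableEq ι]

omit [FiniteDimensional ℝ E] in
lemma section_isBounded {f : ι → E →L[ℝ] ℝ} {S : Finset ι}
    (hb : ∀ h, Bornology.IsBounded (halfspaceInter f S h)) (j : ι) (h : ι → ℝ) :
    Bornology.IsBounded (halfspaceInter (sectionFunctionals f j) (S.erase j) h) := by
  obtain ⟨R, hR⟩ := (hb (Function.update h j 0)).exists_norm_le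
  refine isBounded_iff_forall_norm_le.2 ⟨R, fun y hy => hR y fun i hi => ?_⟩
  rcases eq_or_ne i j with rfl | hij
  · simp
  · simpa [hij, sectionFunctionals] using hy i (Finset.mem_erase.2 ⟨hij, hi⟩)

variable [MeasurableSpace E] [BorelSpace E] (μ : Measure E) [μ.IsAddHaarMeasure]

lemma hasDerivAt_volume_update [Fintype ι] {f : ι → E →L[ℝ] ℝ} {S : Finset ι}
    (hb : ∀ h, Bornology.IsBounded (halfspaceInter f S h)) {j : ι} (hj : j ∈ S)
    {w : E} (hw : f j w = 1) {ν : Measure (f j).ker} [ν.IsAddHaarMeasure]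
    (hν : MeasurePreserving (fun y : ℝ × (f j).ker => y.1 • w + (y.2 : E)) (volume.prod ν) μ)
    {h : ι → ℝ}
    (hne : ∀ i ∈ S.erase j, sectionFunctionals f j i = 0 → sectionOffsets f w j h i ≠ 0) :
    HasDerivAt (fun s => μ.real (halfspaceInter f S (Function.update h j s)))
      (ν.real (halfspaceInter (sectionFunctionals f j) (S.erase j) (sectionOffsets f w j h)))
      (h j) := by
  set φ : ℝ → ℝ := fun s => ν.real (halfspaceInter (sectionFunctionals f j) (S.erase j)
    (fun i => h i - s * f i w)) with hφ
  have hslice : ∀ a s : ℝ, Prod.mk s ⁻¹' ((fun y : ℝ × (f j).ker => y.1 • w + (y.2 : E)) ⁻¹'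
      halfspaceInter f S (Function.update h j a)) =
      if s ≤ a then halfspaceInter (sectionFunctionals f j) (S.erase j)
        (fun i => h i - s * f i w) else ∅ := by
    intro a s
    have hfj : ∀ y : (f j).ker, f j (s • w + (y : E)) = s := fun y => by
      have : f j (y : E) = 0 := y.2
      simp [hw, this]
    ext y
    split_ifs with hs
    · constructor
      · intro hy i hi
        have := hy i (Finset.mem_of_mem_erase hi)
        rw [Function.update_of_ne (Finset.ne_of_mem_erase hi)] at this
        simp only [map_add, map_smul, smul_eq_mul] at this
        simp only [sectionFunctionals, ContinuousLinearMap.comp_apply, Submodule.subtypeL_apply]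
        linarith
      · intro hy i hi
        rcases eq_or_ne i j with rfl | hij
        · simpa [hfj] using hs
        · have := hy i (Finset.mem_erase.2 ⟨hij, hi⟩)
          simp only [sectionFunctionals, ContinuousLinearMap.comp_apply,
            Submodule.subtypeL_apply] at this
          simp only [Function.update_of_ne hij, map_add, map_smul, smul_eq_mul]
          linarith
    · refine iff_of_false (fun hy => hs ?_) (notMem_empty y)
      have := hy j hj
      rwa [hfj, Function.update_self] at this
  have hmeas : ∀ a, MeasurableSet ((fun y : ℝ × (f j).ker => y.1 • w + (y.2 : E)) ⁻¹'
      halfspaceInter f S (Function.update h j a)) := fun a =>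
    hν.measurable (halfspaceInter_measurableSet f S _)
  have hreal : ∀ a s : ℝ, ν.real (Prod.mk s ⁻¹' ((fun y : ℝ × (f j).ker => y.1 • w + (y.2 : E)) ⁻¹'
      halfspaceInter f S (Function.update h j a))) = (Iic a).indicator φ s := by
    intro a s
    rw [hslice]
    by_cases hs : s ≤ a <;> simp [hs, hφ]
  have hpre : ∀ a, (volume.prod ν) ((fun y : ℝ × (f j).ker => y.1 • w + (y.2 : E)) ⁻¹'
      halfspaceInter f S (Function.update h j a)) =
      μ (halfspaceInter f S (Function.update h j a)) := fun a =>
    hν.measure_preimage (halfspaceInter_measurableSet f S _).nullMeasurableSet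
  have hfin : ∀ a, μ (halfspaceInter f S (Function.update h j a)) ≠ ⊤ := fun a =>
    measure_ne_top_of_isBounded μ (hb _)
  have h_integrable : ∀ a, IntegrableOn φ (Iic a) := by
    intro a
    have := Measure.integrable_measure_prodMk_left (hmeas a) (by rw [hpre]; exact hfin a)
    simp only [hreal] at this
    exact (integrable_indicator_iff measurableSet_Iic).1 this
  have hvol : ∀ a, μ.real (halfspaceInter f S (Function.update h j a)) = ∫ s in Iic a, φ s := by
    intro a
    rw [← integral_indicator measurableSet_Iic]
    simp only [← hreal a]
    rw [measureReal_def, ← hpre, Measure.prod_apply (hmeas a)]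
    exact (integral_toReal (measurable_measure_prodMk_left (hmeas a)).aemeasurable
      (ae_of_all _ fun s => by
        rw [hslice]
        split_ifs
        · exact (measure_ne_top_of_isBounded ν (section_isBounded hb j _)).lt_top
        · simp)).symm
  have hφc : ContinuousAt φ (h j) := by
    have hc := continuousAt_volume_halfspaceInter ν (section_isBounded hb j) hne
    have ht : ContinuousAt (fun s : ℝ => (fun i => h i - s * f i w : ι → ℝ)) (h j) := by fun_prop
    exact ContinuousAt.comp (f := fun s : ℝ => (fun i => h i - s * f i w : ι → ℝ)) hc ht
  have hsm : StronglyMeasurableAtFilter φ (𝓝 (h j)) :=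
    ⟨Iic (h j + 1), Iic_mem_nhds (by linarith), (h_integrable _).aestronglyMeasurable⟩
  have hd := (intervalIntegral.integral_hasDerivAt_right (a := h j)
    IntervalIntegrable.refl hsm hφc).const_add (∫ s in Iic (h j), φ s)
  refine hd.congr_of_eventuallyEq (Eventually.of_forall fun a => ?_)
  simp only [hvol]
  rw [← intervalIntegral.integral_Iic_sub_Iic (h_integrable _) (h_integrable _)]
  ring

lemma exists_disintegrations {f : ι → E →L[ℝ] ℝ} {S : Finset ι} (hf : ∀ i ∈ S, f i ≠ 0) :
    ∃ (w : ι → E) (ν : ∀ j, Measure (f j).ker), ∀ j ∈ S, f j (w j) = 1 ∧ (ν j).IsAddHaarMeasure ∧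
      MeasurePreserving (fun y : ℝ × (f j).ker => y.1 • w j + (y.2 : E))
        (volume.prod (ν j)) μ := by
  have key : ∀ j, ∃ (w : E) (ν : Measure (f j).ker), j ∈ S → f j w = 1 ∧ ν.IsAddHaarMeasure ∧
      MeasurePreserving (fun y : ℝ × (f j).ker => y.1 • w + (y.2 : E)) (volume.prod ν) μ := by
    intro j
    by_cases hj : j ∈ S
    · obtain ⟨w, ν, h⟩ := exists_disintegration μ (hf j hj)
      exact ⟨w, ν, fun _ => h⟩
    · exact ⟨0, 0, fun h => absurd h hj⟩
  choose w ν h using key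
  exact ⟨w, ν, h⟩

omit [FiniteDimensional ℝ E] [DecidableEq ι] [MeasurableSpace E] [BorelSpace E] in
lemma continuous_sectionOffsets (f : ι → E →L[ℝ] ℝ) (w : E) (j : ι) :
    Continuous (sectionOffsets f w j) := by
  unfold sectionOffsets
  fun_prop

/-- The gradient of the volume with respect to the offsets is given by the volumes of the facets. -/
lemma hasFDerivAt_volume [Fintype ι] {f : ι → E →L[ℝ] ℝ} {S : Finset ι}
    (hb : ∀ h, Bornology.IsBounded (halfspaceInter f S h))
    {w : ι → E} {ν : ∀ j, Measure (f j).ker}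
    (hν : ∀ j ∈ S, f j (w j) = 1 ∧ (ν j).IsAddHaarMeasure ∧
      MeasurePreserving (fun y : ℝ × (f j).ker => y.1 • w j + (y.2 : E)) (volume.prod (ν j)) μ)
    {h₀ : ι → ℝ} (hne : ∀ j ∈ S, ∀ i ∈ S.erase j,
      sectionFunctionals f j i = 0 → sectionOffsets f (w j) j h₀ i ≠ 0) :
    HasFDerivAt (fun h => μ.real (halfspaceInter f S h))
      (∑ j ∈ S, (ν j).real (halfspaceInter (sectionFunctionals f j) (S.erase j)
        (sectionOffsets f (w j) j h₀)) •
          ContinuousLinearMap.proj (R := ℝ) (φ := fun _ : ι => ℝ) j) h₀ := by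
  have := hasFDerivAt_of_partial (V := fun h => μ.real (halfspaceInter f S h)) (h₀ := h₀)
    (G := fun j h => if j ∈ S then (ν j).real (halfspaceInter (sectionFunctionals f j) (S.erase j)
        (sectionOffsets f (w j) j h)) else 0) ?_ ?_
  · simpa [ite_smul, Finset.sum_ite_mem] using this
  · intro j
    by_cases hj : j ∈ S
    · obtain ⟨hw, hH, hmp⟩ := hν j hj
      have hev : ∀ᶠ h in 𝓝 h₀, ∀ i ∈ S.erase j,
          sectionFunctionals f j i = 0 → sectionOffsets f (w j) j h i ≠ 0 := by
        refine (Finset.eventually_all _).2 fun i hi => ?_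
        by_cases h0 : sectionFunctionals f j i = 0
        · have hc := (continuous_apply i).comp (continuous_sectionOffsets f (w j) j)
          exact (hc.continuousAt.eventually_ne (hne j hj i hi h0)).mono fun _ hh _ => hh
        · exact Eventually.of_forall fun _ h => absurd h h0
      filter_upwards [hev] with h hh
      simpa [hj] using hasDerivAt_volume_update μ hb hj hw hmp hh
    · refine Eventually.of_forall fun h => ?_
      have hconst : (fun s => μ.real (halfspaceInter f S (Function.update h j s))) =
          fun _ => μ.real (halfspaceInter f S h) := by
        ext s
        congr 1
        ext x
        refine forall₂_congr fun i hi => ?_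
        rw [Function.update_of_ne (ne_of_mem_of_not_mem hi hj)]
      rw [hconst]
      simpa [hj] using hasDerivAt_const (h j) (μ.real (halfspaceInter f S h))
  · intro j
    by_cases hj : j ∈ S
    · obtain ⟨hw, hH, hmp⟩ := hν j hj
      simp only [hj, if_true]
      exact ContinuousAt.comp
        (g := fun h => (ν j).real (halfspaceInter (sectionFunctionals f j) (S.erase j) h))
        (continuousAt_volume_halfspaceInter (ν j) (section_isBounded hb j)
        (hne j hj)) (continuous_sectionOffsets f (w j) j).continuousAt
    · simpa [hj] using continuousAt_const

omit [FiniteDimensional ℝ E] [DecidableEq ι] [MeasurableSpace E] [BorelSpace E] in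
lemma eq_smul_of_sectionFunctionals_eq_zero {f : ι → E →L[ℝ] ℝ} {i j : ι} {w : E}
    (hw : f j w = 1) (h : sectionFunctionals f j i = 0) : f i = f i w • f j := by
  ext x
  have hx : x - f j x • w ∈ (f j).ker := by simp [hw]
  have := DFunLike.congr_fun h ⟨_, hx⟩
  simp only [sectionFunctionals, ContinuousLinearMap.comp_apply, Submodule.subtypeL_apply,
    map_sub, map_smul, smul_eq_mul, _root_.zero_apply] at this
  simp only [_root_.smul_apply, smul_eq_mul]
  linarith

omit [FiniteDimensional ℝ E] [MeasurableSpace E] [BorelSpace E] in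
/-- Restricting to the kernel of one functional lowers by at most one the size up to which
subfamilies are linearly independent. -/
lemma sectionFunctionals_independent {f : ι → E →L[ℝ] ℝ} {S : Finset ι} {k : ℕ}
    (hind : ∀ T ⊆ S, T.card ≤ k + 1 → ∀ c : ι → ℝ, ∑ i ∈ T, c i • f i = 0 → ∀ i ∈ T, c i = 0)
    {j : ι} (hj : j ∈ S) {w : E} (hw : f j w = 1) {T : Finset ι} (hT : T ⊆ S.erase j)
    (hcard : T.card ≤ k) {c : ι → ℝ} (hc : ∑ i ∈ T, c i • sectionFunctionals f j i = 0)
    {i : ι} (hi : i ∈ T) : c i = 0 := by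
  have hjT : j ∉ T := fun h => Finset.notMem_erase j S (hT h)
  have hT' : insert j T ⊆ S :=
    Finset.insert_subset hj (hT.trans (Finset.erase_subset j S))
  have hsum : ∑ i ∈ insert j T,
      Function.update c j (-∑ i ∈ T, c i * f i w) i • f i = 0 := by
    rw [Finset.sum_insert hjT, Function.update_self]
    have hcongr : ∑ i ∈ T, Function.update c j (-∑ i ∈ T, c i * f i w) i • f i =
        ∑ i ∈ T, c i • f i := Finset.sum_congr rfl fun i hi => by
      rw [Function.update_of_ne (ne_of_mem_of_not_mem hi hjT)]
    rw [hcongr]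
    ext x
    have hx : x - f j x • w ∈ (f j).ker := by simp [hw]
    have := DFunLike.congr_fun hc ⟨_, hx⟩
    simp only [sectionFunctionals, _root_.sum_apply, _root_.smul_apply,
      ContinuousLinearMap.comp_apply, Submodule.subtypeL_apply, map_sub, map_smul, smul_eq_mul,
      _root_.zero_apply, mul_sub, Finset.sum_sub_distrib] at this
    simp only [_root_.sum_apply, _root_.smul_apply, smul_eq_mul,
      _root_.zero_apply, _root_.add_apply]
    have hmul : ∑ i ∈ T, c i * (f j x * f i w) = (∑ i ∈ T, c i * f i w) * f j x := by
      rw [Finset.sum_mul]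
      exact Finset.sum_congr rfl fun i _ => by ring
    linarith
  have := hind _ hT' ((Finset.card_insert_le _ _).trans (by omega)) _ hsum i
    (Finset.mem_insert_of_mem hi)
  rwa [Function.update_of_ne (ne_of_mem_of_not_mem hi hjT)] at this

end Derivative

/-- If every `k + 1` of the functionals are linearly independent, the volume is a `C^k` function
of the offsets. -/
theorem contDiff_volume_halfspaceInter {ι : Type*} [Fintype ι] [DecidableEq ι] (k : ℕ) :
    ∀ {E : Type} [NormedAddCommGroup E] [NormedSpace ℝ E] [FiniteDimensional ℝ E]
      [MeasurableSpace E] [BorelSpace E] (μ : Measure E) [μ.IsAddHaarMeasure]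
      {f : ι → E →L[ℝ] ℝ} {S : Finset ι},
      (∀ h, Bornology.IsBounded (halfspaceInter f S h)) →
      (∀ T ⊆ S, T.card ≤ k + 1 → ∀ c : ι → ℝ, ∑ i ∈ T, c i • f i = 0 → ∀ i ∈ T, c i = 0) →
      ContDiff ℝ k (fun h => μ.real (halfspaceInter f S h)) := by
  have hne_zero : ∀ {E : Type} [NormedAddCommGroup E] [NormedSpace ℝ E] {k : ℕ}
      {f : ι → E →L[ℝ] ℝ} {S : Finset ι},
      (∀ T ⊆ S, T.card ≤ k + 1 → ∀ c : ι → ℝ, ∑ i ∈ T, c i • f i = 0 → ∀ i ∈ T, c i = 0) →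
      ∀ i ∈ S, f i ≠ 0 := by
    intro E _ _ k f S hind i hi h0
    exact one_ne_zero (hind {i} (Finset.singleton_subset_iff.2 hi) (by simp) (fun _ => (1 : ℝ))
      (by simp [h0]) i (Finset.mem_singleton_self i))
  induction k with
  | zero =>
    intro E _ _ _ _ _ μ _ f S hb hind
    rw [Nat.cast_zero, contDiff_zero, continuous_iff_continuousAt]
    exact fun h₀ => continuousAt_volume_halfspaceInter μ hb
      fun i hi h0 => absurd h0 (hne_zero hind i hi)
  | succ k ih =>
    intro E _ _ _ _ _ μ _ f S hb hind
    obtain ⟨w, ν, hν⟩ := exists_disintegrations μ (hne_zero hind)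
    have hsec : ∀ j ∈ S, ∀ T ⊆ S.erase j, T.card ≤ k + 1 → ∀ c : ι → ℝ,
        ∑ i ∈ T, c i • sectionFunctionals f j i = 0 → ∀ i ∈ T, c i = 0 :=
      fun j hj T hT hcard c hc i hi =>
        sectionFunctionals_independent hind hj (hν j hj).1 hT hcard hc hi
    rw [Nat.cast_succ, contDiff_succ_iff_hasFDerivAt]
    refine ⟨_, ?_, fun h₀ => hasFDerivAt_volume μ hb hν fun j hj i hi h0 =>
      absurd h0 (hne_zero (hsec j hj) i hi)⟩
    refine ContDiff.sum fun j hj => ContDiff.fun_smul ?_ contDiff_const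
    obtain ⟨hw, hH, hmp⟩ := hν j hj
    refine (ih (ν j) (section_isBounded hb j) (hsec j hj)).comp ?_
    unfold sectionOffsets
    fun_prop

section LocallyPolynomial

open Polynomial

/-- Away from finitely many points, `W` is locally a polynomial of degree at most `n`. -/
def IsLocallyPolynomial (n : ℕ) (W : ℝ → ℝ) : Prop :=
  ∃ T : Finset ℝ, ∀ t ∉ T, ∃ q : ℝ[X], q.natDegree ≤ n ∧ W =ᶠ[𝓝 t] fun s => q.eval s

lemma isLocallyPolynomial_const (n : ℕ) (c : ℝ) : IsLocallyPolynomial n fun _ => c :=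
  ⟨∅, fun _ _ => ⟨C c, by simp, by simp⟩⟩

lemma exists_affine_root {α β : ℝ} (h : ¬ ∀ t, α + t * β = 0) :
    ∃ z, ∀ t, t ≠ z → α + t * β ≠ 0 := by
  refine ⟨-α / β, fun t ht h0 => ?_⟩
  by_cases hβ : β = 0
  · simp_all
  · exact ht (by rw [eq_div_iff hβ]; linarith)

/-- Gluing along the sign of an affine function. -/
lemma IsLocallyPolynomial.ite_affine {n : ℕ} {W : ℝ → ℝ} (hW : IsLocallyPolynomial n W)
    (α β : ℝ) : IsLocallyPolynomial n fun t => if 0 ≤ α + t * β then W t else 0 := by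
  by_cases h0 : ∀ t, α + t * β = 0
  · simpa [h0] using hW
  obtain ⟨T, hT⟩ := hW
  obtain ⟨z, hz⟩ := exists_affine_root h0
  refine ⟨insert z T, fun t ht => ?_⟩
  rw [Finset.mem_insert, not_or] at ht
  have hc : ContinuousAt (fun t : ℝ => α + t * β) t := by fun_prop
  rcases (hz t ht.1).lt_or_gt with hlt | hgt
  · refine ⟨0, by simp, ?_⟩
    filter_upwards [hc.eventually_lt_const hlt] with s hs
    simp [hs.not_ge]
  · obtain ⟨q, hq, hWq⟩ := hT t ht.2
    refine ⟨q, hq, ?_⟩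
    filter_upwards [hc.eventually_const_lt hgt, hWq] with s hs hs'
    simp [hs.le, hs']

lemma exists_antiderivative (q : ℝ[X]) :
    ∃ Q : ℝ[X], derivative Q = q ∧ Q.natDegree ≤ q.natDegree + 1 := by
  refine ⟨∑ i ∈ Finset.range (q.natDegree + 1), monomial (i + 1) (q.coeff i / (i + 1)), ?_, ?_⟩
  · conv_rhs => rw [q.as_sum_range]
    rw [derivative_sum]
    refine Finset.sum_congr rfl fun i _ => ?_
    rw [derivative_monomial]
    have : (i : ℝ) + 1 ≠ 0 := by positivity
    simp [div_mul_cancel₀ _ this]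
  · refine natDegree_sum_le_of_forall_le _ _ fun i hi => (natDegree_monomial_le _).trans ?_
    simpa using Finset.mem_range.1 hi

/-- A function whose derivative is locally a polynomial is locally a polynomial. -/
lemma IsLocallyPolynomial.of_hasDerivAt {n : ℕ} {W W' : ℝ → ℝ} (hW' : IsLocallyPolynomial n W')
    {T : Finset ℝ} (hd : ∀ t ∉ T, HasDerivAt W (W' t) t) : IsLocallyPolynomial (n + 1) W := by
  classical
  obtain ⟨T', hT'⟩ := hW'
  refine ⟨T ∪ T', fun t ht => ?_⟩
  rw [Finset.mem_union, not_or] at ht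
  obtain ⟨q, hq, hWq⟩ := hT' t ht.2
  obtain ⟨Q, hQ, hQd⟩ := exists_antiderivative q
  have hnear : ∀ᶠ s in 𝓝 t, HasDerivAt W (q.eval s) s := by
    filter_upwards [hWq, T.finite_toSet.isClosed.isOpen_compl.mem_nhds ht.1] with s hs hsT
    exact hs ▸ hd s hsT
  obtain ⟨r, hr, hball⟩ := Metric.eventually_nhds_iff_ball.1 hnear
  refine ⟨Q + C (W t - Q.eval t), ?_, ?_⟩
  · rw [natDegree_add_C]
    omega
  · refine (isOpen_ball.eqOn_of_deriv_eq (convex_ball t r).isPreconnected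
      (fun s hs => (hball s hs).differentiableAt.differentiableWithinAt)
      (Polynomial.differentiable _).differentiableOn (fun s hs => ?_) (mem_ball_self hr)
      (by simp)).eventuallyEq_of_mem (ball_mem_nhds t hr)
    rw [(hball s hs).deriv, Polynomial.deriv]
    simp [hQ]

lemma IsLocallyPolynomial.sum {α : Type*} {n : ℕ} {W : α → ℝ → ℝ} (S : Finset α)
    (hW : ∀ j ∈ S, IsLocallyPolynomial n (W j)) (c : α → ℝ) :
    IsLocallyPolynomial n fun t => ∑ j ∈ S, W j t * c j := by
  classical
  choose! T hT using hW
  refine ⟨S.biUnion T, fun t ht => ?_⟩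
  simp only [Finset.mem_biUnion, not_exists, not_and] at ht
  choose! q hq hWq using fun j hj => hT j hj t (ht j hj)
  refine ⟨∑ j ∈ S, q j * C (c j), natDegree_sum_le_of_forall_le _ _ fun j hj =>
    (natDegree_mul_C_le _ _).trans (hq j hj), ?_⟩
  filter_upwards [(Finset.eventually_all S).2 fun j hj => hWq j hj] with s hs
  rw [eval_finsetSum]
  exact Finset.sum_congr rfl fun j hj => by rw [hs j hj, eval_mul, eval_C]

lemma exists_polynomial_of_isPreconnected {n : ℕ} {W : ℝ → ℝ} {U : Set ℝ} (hU : IsPreconnected U)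
    (hW : ∀ t ∈ U, ∃ q : ℝ[X], q.natDegree ≤ n ∧ W =ᶠ[𝓝 t] fun s => q.eval s) :
    ∃ q : ℝ[X], q.natDegree ≤ n ∧ EqOn W (fun s => q.eval s) U := by
  rcases U.eq_empty_or_nonempty with rfl | ⟨t₀, ht₀⟩
  · exact ⟨0, by simp, eqOn_empty _ _⟩
  obtain ⟨q, hq, hWq⟩ := hW t₀ ht₀
  refine ⟨q, hq, ?_⟩
  have hsub : U ⊆ {t | W =ᶠ[𝓝 t] fun s => q.eval s} := by
    refine hU.subset_of_closure_inter_subset isOpen_setOfPred_eventually_nhds ⟨t₀, ht₀, hWq⟩ ?_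
    rintro t ⟨htc, htU⟩
    obtain ⟨p, -, hp⟩ := hW t htU
    obtain ⟨s, hs, hps⟩ := (mem_closure_iff_frequently.1 htc).and_eventually
      (eventually_eventuallyEq_nhds.2 hp) |>.exists
    have heq : p = q := Polynomial.eq_of_infinite_eval_eq p q
      (infinite_of_mem_nhds s (hps.symm.trans hs))
    exact heq ▸ hp
  exact fun t ht => (hsub ht).self_of_nhds

/-- A continuous function that is locally polynomial away from finitely many points is
piecewise polynomial. -/
lemma IsLocallyPolynomial.exists_pieces {d : ℕ} {W : ℝ → ℝ} (hW : IsLocallyPolynomial d W)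
    (hc : Continuous W) :
    ∃ (n : ℕ) (g : Fin (n + 1) → ℝ) (q : Fin (n + 2) → ℝ[X]),
      StrictMono g ∧ (∀ i, (q i).natDegree ≤ d) ∧
      (∀ t, t ≤ g 0 → W t = (q 0).eval t) ∧
      (∀ i : Fin n, ∀ t ∈ Icc (g i.castSucc) (g i.succ), W t = (q i.succ.castSucc).eval t) ∧
      (∀ t, g (Fin.last n) ≤ t → W t = (q (Fin.last (n + 1))).eval t) := by
  obtain ⟨T, hT⟩ := hW
  obtain ⟨n, hn⟩ : ∃ n, (insert 0 T).card = n + 1 :=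
    Nat.exists_eq_succ_of_ne_zero (Finset.card_ne_zero_of_mem (Finset.mem_insert_self 0 T))
  set g := (insert 0 T).orderEmbOfFin hn with hg
  have hmem : ∀ t ∈ T, ∃ i, g i = t := fun t ht => by
    have : t ∈ Set.range g := by
      rw [hg, Finset.range_orderEmbOfFin]
      exact Finset.mem_coe.2 (Finset.mem_insert_of_mem ht)
    exact this
  have piece : ∀ U : Set ℝ, IsPreconnected U → (∀ i, g i ∉ U) →
      ∃ q : ℝ[X], q.natDegree ≤ d ∧ EqOn W (fun s => q.eval s) (closure U) := by
    intro U hU hgU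
    obtain ⟨q, hq, hWq⟩ := exists_polynomial_of_isPreconnected hU fun t ht => hT t fun htT => by
      obtain ⟨i, rfl⟩ := hmem t htT
      exact hgU i ht
    exact ⟨q, hq, hWq.closure hc q.continuous⟩
  obtain ⟨q₀, hq₀, hW₀⟩ := piece (Iio (g 0)) isPreconnected_Iio
    fun i hi => (g.lt_iff_lt.1 hi).not_ge (Fin.zero_le i)
  obtain ⟨q₁, hq₁, hW₁⟩ := piece (Ioi (g (Fin.last n))) isPreconnected_Ioi
    fun i hi => (g.lt_iff_lt.1 hi).not_ge (Fin.le_last i)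
  choose q hq hWq using fun i : Fin n => piece (Ioo (g i.castSucc) (g i.succ)) isPreconnected_Ioo
    fun j hj => by
      have h1 := Fin.lt_def.1 (g.lt_iff_lt.1 hj.1)
      have h2 := Fin.lt_def.1 (g.lt_iff_lt.1 hj.2)
      rw [Fin.val_castSucc] at h1
      rw [Fin.val_succ] at h2
      omega
  refine ⟨n, g, Fin.cons (α := fun _ => ℝ[X]) q₀ (Fin.snoc (α := fun _ => ℝ[X]) q q₁),
    g.strictMono, fun i => ?_, fun t ht => ?_, fun i t ht => ?_, fun t ht => ?_⟩
  · refine Fin.cases (by simpa using hq₀) (fun i => ?_) i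
    refine Fin.lastCases (by simpa using hq₁) (fun i => by simpa using hq i) i
  · simpa using hW₀ (by simpa using ht)
  · have hlt : g i.castSucc < g i.succ := g.strictMono i.castSucc_lt_succ
    have := hWq i (by rwa [closure_Ioo hlt.ne])
    rw [← Fin.succ_castSucc, Fin.cons_succ, Fin.snoc_castSucc]
    exact this
  · rw [← Fin.succ_last, Fin.cons_succ, Fin.snoc_last]
    exact hW₁ (by simpa using ht)

end LocallyPolynomial

section PiecewisePolynomial

variable {ι : Type*} [DecidableEq ι]

lemma halfspaceInter_of_eq_zero {E : Type*} [NormedAddCommGroup E] [NormedSpace ℝ E]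
    {f : ι → E →L[ℝ] ℝ} {S : Finset ι} {i : ι} (hi : i ∈ S) (h0 : f i = 0) (h : ι → ℝ) :
    halfspaceInter f S h = if 0 ≤ h i then halfspaceInter f (S.erase i) h else ∅ := by
  ext x
  split_ifs with hh
  · refine ⟨fun hx l hl => hx l (Finset.mem_of_mem_erase hl), fun hx l hl => ?_⟩
    rcases eq_or_ne l i with rfl | hne
    · simpa [h0] using hh
    · exact hx l (Finset.mem_erase.2 ⟨hne, hl⟩)
  · exact iff_of_false (fun hx => hh (by simpa [h0] using hx i hi)) (notMem_empty x)

lemma halfspaceInter_erase_of_eq_smul {E : Type*} [NormedAddCommGroup E] [NormedSpace ℝ E]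
    {f : ι → E →L[ℝ] ℝ} {S : Finset ι} {i j : ι} (hj : j ∈ S) (hij : i ≠ j) {c : ℝ} (hc : 0 ≤ c)
    (hf : f i = c • f j) {h : ι → ℝ} (hh : h i = c * h j) :
    halfspaceInter f S h = halfspaceInter f (S.erase i) h := by
  ext x
  refine ⟨fun hx l hl => hx l (Finset.mem_of_mem_erase hl), fun hx l hl => ?_⟩
  rcases eq_or_ne l i with rfl | hne
  · rw [hf, hh]
    exact mul_le_mul_of_nonneg_left (hx j (Finset.mem_erase.2 ⟨hij.symm, hj⟩)) hc
  · exact hx l (Finset.mem_erase.2 ⟨hne, hl⟩)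

lemma halfspaceInter_erase_update {E : Type*} [NormedAddCommGroup E] [NormedSpace ℝ E]
    (f : ι → E →L[ℝ] ℝ) (S : Finset ι) (i : ι) (h : ι → ℝ) (c : ℝ) :
    halfspaceInter f (S.erase i) (Function.update h i c) = halfspaceInter f (S.erase i) h := by
  ext x
  refine forall₂_congr fun l hl => ?_
  rw [Function.update_of_ne (Finset.ne_of_mem_erase hl)]

/-- The volume of an intersection of half-spaces whose offsets depend affinely on `t` is locally
a polynomial in `t` of degree at most the dimension, away from finitely many times. -/
theorem isLocallyPolynomial_volume [Fintype ι] (n : ℕ) :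
    ∀ {E : Type} [NormedAddCommGroup E] [NormedSpace ℝ E] [FiniteDimensional ℝ E]
      [MeasurableSpace E] [BorelSpace E] (μ : Measure E) [μ.IsAddHaarMeasure],
      Module.finrank ℝ E = n → ∀ (S : Finset ι) (f : ι → E →L[ℝ] ℝ) (a b : ι → ℝ),
      (∀ h, Bornology.IsBounded (halfspaceInter f S h)) →
      IsLocallyPolynomial n fun t => μ.real (halfspaceInter f S fun i => a i + t * b i) := by
  induction n using Nat.strong_induction_on with
  | h n ihn =>
  intro E _ _ _ _ _ μ _ hdim S
  induction S using Finset.strongInduction with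
  | H S ihS =>
  intro f a b hb
  by_cases hzero : ∃ i ∈ S, f i = 0
  · obtain ⟨i, hi, h0⟩ := hzero
    have hb' : ∀ h, Bornology.IsBounded (halfspaceInter f (S.erase i) h) := fun h => by
      have := hb (Function.update h i 0)
      rwa [halfspaceInter_of_eq_zero hi h0, Function.update_self, if_pos le_rfl,
        halfspaceInter_erase_update] at this
    convert (ihS _ (Finset.erase_ssubset hi) f a b hb').ite_affine (a i) (b i) using 2 with t
    rw [halfspaceInter_of_eq_zero hi h0]
    split_ifs <;> simp
  push Not at hzero
  obtain ⟨w, ν, hν⟩ := exists_disintegrations μ hzero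
  by_cases hdup : ∃ j ∈ S, ∃ i ∈ S.erase j, sectionFunctionals f j i = 0 ∧
      ∀ t : ℝ, sectionOffsets f (w j) j (fun i => a i + t * b i) i = 0
  · obtain ⟨j, hj, i, hi, h0, hoff⟩ := hdup
    have hiS := Finset.mem_of_mem_erase hi
    have hij := Finset.ne_of_mem_erase hi
    have hf := eq_smul_of_sectionFunctionals_eq_zero (hν j hj).1 h0
    have hh : ∀ t : ℝ, a i + t * b i = f i (w j) * (a j + t * b j) := fun t => by
      have := hoff t
      simp only [sectionOffsets] at this
      linarith
    rcases le_or_gt 0 (f i (w j)) with hpos | hneg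
    · have hb' : ∀ h, Bornology.IsBounded (halfspaceInter f (S.erase i) h) := fun h => by
        rw [← halfspaceInter_erase_update f S i h (f i (w j) * h j),
          ← halfspaceInter_erase_of_eq_smul hj hij hpos hf (by simp [hij.symm])]
        exact hb _
      convert ihS _ (Finset.erase_ssubset hiS) f a b hb' using 3 with t
      exact halfspaceInter_erase_of_eq_smul (h := fun i => a i + t * b i)
        hj hij hpos hf (hh t)
    · convert isLocallyPolynomial_const n 0 using 2 with t
      refine (measureReal_eq_zero_iff (measure_ne_top_of_isBounded μ (hb _))).2
        (measure_mono_null (fun x hx => ?_)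
          (measure_hyperplane_eq_zero_s4 μ (hzero j hj) (a j + t * b j)))
      refine (hx j hj).antisymm ?_
      have : f i (w j) * f j x ≤ f i (w j) * (a j + t * b j) := by
        rw [← hh]
        exact (DFunLike.congr_fun hf x).ge.trans (hx i hiS)
      exact (mul_le_mul_left_of_neg hneg).1 this
  push Not at hdup
  rcases S.eq_empty_or_nonempty with rfl | ⟨j₀, hj₀⟩
  · simpa [halfspaceInter] using isLocallyPolynomial_const n (μ.real univ)
  obtain ⟨n, rfl⟩ : ∃ n', n = n' + 1 := by
    have := Module.Dual.finrank_ker_add_one_of_ne_zero (f := (f j₀).toLinearMap)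
      (fun h => hzero j₀ hj₀ (ContinuousLinearMap.coe_injective h))
    exact ⟨_, hdim ▸ this.symm⟩
  have hfacet : ∀ j ∈ S, IsLocallyPolynomial n fun t =>
      (ν j).real (halfspaceInter (sectionFunctionals f j) (S.erase j)
        (sectionOffsets f (w j) j fun i => a i + t * b i)) := by
    intro j hj
    have := (hν j hj).2.1
    have hker := Module.Dual.finrank_ker_add_one_of_ne_zero (f := (f j).toLinearMap)
      (fun h => hzero j hj (ContinuousLinearMap.coe_injective h))
    convert ihn n (Nat.lt_succ_self n) (ν j) (by omega) (S.erase j) (sectionFunctionals f j)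
      (sectionOffsets f (w j) j a) (sectionOffsets f (w j) j b) (section_isBounded hb j)
      using 5 with t i
    simp only [sectionOffsets]
    ring
  have hbad : ∀ j ∈ S, ∀ i ∈ S.erase j, sectionFunctionals f j i = 0 →
      ∃ z, ∀ t : ℝ, t ≠ z → sectionOffsets f (w j) j (fun i => a i + t * b i) i ≠ 0 := by
    intro j hj i hi h0
    obtain ⟨t, ht⟩ := hdup j hj i hi h0
    have heq : ∀ t : ℝ, sectionOffsets f (w j) j (fun i => a i + t * b i) i =
        sectionOffsets f (w j) j a i + t * sectionOffsets f (w j) j b i := fun t => by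
      simp only [sectionOffsets]
      ring
    simp only [heq] at ht ⊢
    exact exists_affine_root fun h => ht (h t)
  choose! z hz using hbad
  refine (IsLocallyPolynomial.sum S hfacet b).of_hasDerivAt
    (T := S.biUnion fun j => (S.erase j).image (z j)) fun t ht => ?_
  have hd := hasFDerivAt_volume μ hb hν (h₀ := fun i => a i + t * b i)
    fun j hj i hi h0 => hz j hj i hi h0 t fun hti => ht
      (Finset.mem_biUnion.2 ⟨j, hj, Finset.mem_image.2 ⟨i, hi, hti.symm⟩⟩)
  have hline : HasDerivAt (fun t : ℝ => fun i => a i + t * b i) b t := by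
    refine hasDerivAt_pi.2 fun i => ?_
    simpa using ((hasDerivAt_id' t).mul_const (b i)).const_add (a i)
  have hcomp := hd.comp_hasDerivAt t hline
  simpa [Function.comp_def] using hcomp

end PiecewisePolynomial

/-- The functionals defining a cell of an arrangement as an intersection of half-spaces. -/
noncomputable def cellFunctionals {d m : ℕ} (N : Fin m → EuclideanSpace ℝ (Fin d))
    (ε : Fin m → ℝ) (j : Fin m) : EuclideanSpace ℝ (Fin d) →L[ℝ] ℝ :=
  (-ε j) • innerSL ℝ (N j)

lemma glidingCell_eq_halfspaceInter {d m : ℕ} (p N v : Fin m → EuclideanSpace ℝ (Fin d))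
    (ε : Fin m → ℝ) (t : ℝ) :
    glidingCell p N v ε t = halfspaceInter (cellFunctionals N ε) Finset.univ
      (fun j => -ε j * ⟪p j, N j⟫ + t * (-ε j * ⟪v j, N j⟫)) := by
  ext x
  simp only [glidingCell, halfspaceInter, cellFunctionals, mem_ofPred_eq, Finset.mem_univ,
    forall_true_left, _root_.smul_apply, innerSL_apply_apply, smul_eq_mul, inner_sub_left]
  refine forall_congr' fun j => ?_
  rw [real_inner_comm x (N j), ← sub_nonneg (b := -ε j * _)]
  ring_nf

lemma AbsoluteRank.linearIndependent {E : Type*} [AddCommGroup E] [Module ℝ E] {m k : ℕ}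
    {N : Fin m → E} (hN : AbsoluteRank N k) {T : Finset (Fin m)} (hT : T.card ≤ k)
    {c : Fin m → ℝ} (hc : ∑ i ∈ T, c i • N i = 0) : ∀ i ∈ T, c i = 0 := by
  obtain ⟨U, hU, -⟩ := hN.2
  have hkm : k ≤ (Finset.univ : Finset (Fin m)).card :=
    (Nat.le_succ k).trans (hU.ge.trans (Finset.card_le_card (Finset.subset_univ U)))
  obtain ⟨T', hTT', -, hcard⟩ :=
    Finset.exists_subsuperset_card_eq (Finset.subset_univ T) hT hkm
  have hli : LinearIndepOn ℝ N (T' : Set (Fin m)) := hN.1 T' hcard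
  exact linearIndepOn_finset_iff.1 (hli.mono (Finset.coe_subset.2 hTT')) c hc

/-- For a gliding `d`-arrangement of first type with unit normals of absolute
rank `k` and a bounded cell `C_ε` of nonzero volume at some time, the volume function
`W(t) = vol_d(C_ε(t))` is continuous, piecewise polynomial of degree at most `d` with finitely
many pieces, and of class `C^{k-1}` on `ℝ`. -/
theorem statement4 {d m k : ℕ}
    (p N v : Fin m → EuclideanSpace ℝ (Fin d))
    (hN : ∀ j, ‖N j‖ = 1)
    (ε : Fin m → ℝ) (hε : ∀ j, ε j = 1 ∨ ε j = -1)
    (hrank : AbsoluteRank N k)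
    (hcell : ∃ t₀ : ℝ, Bornology.IsBounded (glidingCell p N v ε t₀) ∧
      volume (glidingCell p N v ε t₀) ≠ 0) :
    Continuous (fun t => (volume (glidingCell p N v ε t)).toReal) ∧
    (∃ (n : ℕ) (g : Fin (n + 1) → ℝ) (q : Fin (n + 2) → Polynomial ℝ),
      StrictMono g ∧ (∀ i, (q i).natDegree ≤ d) ∧
      (∀ t, t ≤ g 0 → (volume (glidingCell p N v ε t)).toReal = (q 0).eval t) ∧
      (∀ i : Fin n, ∀ t ∈ Icc (g i.castSucc) (g i.succ),
        (volume (glidingCell p N v ε t)).toReal = (q i.succ.castSucc).eval t) ∧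
      (∀ t, g (Fin.last n) ≤ t →
        (volume (glidingCell p N v ε t)).toReal = (q (Fin.last (n + 1))).eval t)) ∧
    ContDiff ℝ (k - 1 : ℕ) (fun t => (volume (glidingCell p N v ε t)).toReal) := by
  have hε0 : ∀ j, -ε j ≠ 0 := fun j => by rcases hε j with h | h <;> simp [h]
  have hf0 : ∀ j ∈ Finset.univ, cellFunctionals N ε j ≠ 0 := fun j _ h => by
    have := DFunLike.congr_fun h (N j)
    simp [cellFunctionals, hN j, neg_ne_zero.1 (hε0 j)] at this
  obtain ⟨t₀, hbdd, hvol⟩ := hcell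
  rw [glidingCell_eq_halfspaceInter] at hbdd hvol
  have hb := halfspaceInter_isBounded volume hf0 hbdd hvol
  simp only [glidingCell_eq_halfspaceInter, ← measureReal_def]
  have hind : ∀ T ⊆ Finset.univ, T.card ≤ k → ∀ c : Fin m → ℝ,
      ∑ i ∈ T, c i • cellFunctionals N ε i = 0 → ∀ i ∈ T, c i = 0 := by
    intro T _ hT c hc i hi
    have hsum : ∑ i ∈ T, (c i * -ε i) • N i = 0 := by
      refine ext_inner_right ℝ fun x => ?_
      have := DFunLike.congr_fun hc x
      simpa [cellFunctionals, sum_inner, inner_smul_left, mul_assoc] using this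
    exact (mul_eq_zero.1 (hrank.linearIndependent hT hsum i hi)).resolve_right (hε0 i)
  have hsmooth : ContDiff ℝ (k - 1 : ℕ) fun h =>
      volume.real (halfspaceInter (cellFunctionals N ε) Finset.univ h) := by
    refine contDiff_volume_halfspaceInter (k - 1) volume hb fun T hT hcard c hc i hi => ?_
    rcases Nat.eq_zero_or_pos k with rfl | hk
    · have hTi : T = {i} :=
        Finset.eq_singleton_iff_unique_mem.2
          ⟨hi, fun l hl => Finset.card_le_one.1 (by simpa using hcard) l hl i hi⟩
      rw [hTi, Finset.sum_singleton] at hc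
      exact (smul_eq_zero.1 hc).resolve_right (hf0 i (Finset.mem_univ i))
    · exact hind T hT (by omega) c hc i hi
  have hW : ContDiff ℝ (k - 1 : ℕ) fun t : ℝ => volume.real (halfspaceInter
      (cellFunctionals N ε) Finset.univ
        (fun j => -ε j * ⟪p j, N j⟫ + t * (-ε j * ⟪v j, N j⟫))) :=
    hsmooth.comp (by fun_prop)
  exact ⟨hW.continuous, (isLocallyPolynomial_volume d volume (by simp) Finset.univ
    (cellFunctionals N ε) _ _ hb).exists_pieces hW.continuous, hW⟩
end
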